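/- arXiv:1702.04745 — 2 statements merged into one kernel-verified Lean document; each statement's English description precedes it below -/
import Mathlib

section
/- For n ≥ 1, let X_n be the random variable 'total height' (sum over all vertices of the graph distance to the root) on the set of rooted labeled trees on n vertices (pairs (T,r) where T is a tree on vertex set {1,…,n} and r is a distinguished root vertex), equipped with the uniform distribution. Let μ(n) = E[X_n], m_i(n) = E[(X_n − μ(n))^i], and α_i(n) = m_i(n)/m_2(n)^{i/2}. Then the limit of the skewness exists and lim_{n→∞} α_3(n) = (6π − 75/4)·√3·√(π/(10 − 3π)) / (10 − 3π) ≈ 0.70056652935965…. -/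
open Classical in
/-- The set of rooted labeled trees on `n` vertices: pairs `(T, r)` where `T` is a
tree (connected acyclic simple graph) on the vertex set `{1,…,n}` (modeled as `Fin n`)
and `r` is a distinguished root vertex. -/
noncomputable def RootedLabeledTrees (n : ℕ) : Finset (SimpleGraph (Fin n) × Fin n) :=
  Finset.univ.filter (fun p => p.1.IsTree)

/-- The total height of a rooted labeled tree `(T, r)`: the sum over all vertices `v`
of the graph distance in `T` from `v` to the root `r`. -/
noncomputable def rlTotalHeight (n : ℕ) (p : SimpleGraph (Fin n) × Fin n) : ℕ :=
  ∑ v : Fin n, p.1.dist v p.2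

/-- The mean of the total height on rooted labeled trees on `n` vertices, under the
uniform distribution. -/
noncomputable def rlMu (n : ℕ) : ℝ :=
  (∑ p ∈ RootedLabeledTrees n, (rlTotalHeight n p : ℝ)) / ((RootedLabeledTrees n).card : ℝ)

/-- The `i`-th central moment of the total height on rooted labeled trees on `n`
vertices, under the uniform distribution. -/
noncomputable def rlCentralMoment (i n : ℕ) : ℝ :=
  (∑ p ∈ RootedLabeledTrees n, ((rlTotalHeight n p : ℝ) - rlMu n) ^ i) /
    ((RootedLabeledTrees n).card : ℝ)

/-- The `i`-th scaled moment `α_i(n) = m_i(n) / m_2(n)^(i/2)` of the total height on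
rooted labeled trees on `n` vertices. -/
noncomputable def rlAlpha (i n : ℕ) : ℝ :=
  rlCentralMoment i n / (rlCentralMoment 2 n) ^ ((i : ℝ) / 2)

namespace TH
/-- rooted tree given by parent function and depth function -/
@[ext] structure RT (V : Type) where
  r : V
  f : V → V
  d : V → ℕ
  hf : f r = r
  hd0 : d r = 0
  hd : ∀ v, v ≠ r → d v = d (f v) + 1

namespace RT
variable {V : Type}

lemma d_unique (s t : RT V) (hr : s.r = t.r) (hf : s.f = t.f) : s.d = t.d := by
  have key : ∀ k v, s.d v = k → t.d v = k := by
    intro k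
    induction k using Nat.strong_induction_on with
    | _ k ih =>
      intro v hv
      by_cases h : v = s.r
      · subst h
        rw [s.hd0] at hv
        rw [← hv, hr, t.hd0]
      · have h1 := s.hd v h
        have h2 := t.hd v (by rwa [← hr])
        have h3 := ih (s.d (s.f v)) (by omega) (s.f v) rfl
        rw [← hf, h3] at h2
        omega
  funext v
  exact (key _ v rfl).symm

instance [Finite V] : Finite (RT V) := by
  apply Finite.of_injective (fun t : RT V => (t.r, t.f))
  intro s t h
  simp only [Prod.mk.injEq] at h
  exact RT.ext h.1 h.2 (d_unique s t h.1 h.2)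

noncomputable instance [Finite V] : Fintype (RT V) := Fintype.ofFinite _

lemma d_eq_zero (t : RT V) {v : V} : t.d v = 0 ↔ v = t.r := by
  constructor
  · intro h
    by_contra hne
    have := t.hd v hne
    omega
  · rintro rfl
    exact t.hd0

/-- the total of depth + 1 -/
noncomputable def Y [Fintype V] (t : RT V) : ℕ := ∑ v, (t.d v + 1)

/-- the child of the root above v -/
def top (t : RT V) (v : V) : V := t.f^[t.d v - 1] v

lemma top_of_d_one (t : RT V) {v : V} (h : t.d v = 1) : t.top v = v := by
  simp [top, h]

lemma top_f (t : RT V) {v : V} (h : 2 ≤ t.d v) : t.top (t.f v) = t.top v := by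
  have hv : v ≠ t.r := by
    intro h'
    rw [t.d_eq_zero.2 h'] at h
    omega
  have h1 := t.hd v hv
  unfold top
  obtain ⟨k, hk⟩ : ∃ k, t.d (t.f v) = k + 1 := ⟨t.d (t.f v) - 1, by omega⟩
  rw [h1, hk]
  simp [Function.iterate_succ_apply]

lemma d_top (t : RT V) {v : V} (h : 1 ≤ t.d v) : t.d (t.top v) = 1 := by
  obtain ⟨k, hk⟩ : ∃ k, t.d v = k + 1 := ⟨t.d v - 1, by omega⟩
  induction k generalizing v with
  | zero => rw [t.top_of_d_one hk]; exact hk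
  | succ k ih =>
    have hv : v ≠ t.r := by
      intro h'
      rw [t.d_eq_zero.2 h'] at h
      omega
    have h1 := t.hd v hv
    rw [← t.top_f (by omega)]
    exact ih (by omega) (by omega)

section glue
variable [DecidableEq V] (K : Finset V)

/-- glue two rooted trees, hanging the first below the root of the second -/
def glue (a : RT {x // x ∈ K}) (b : RT {x // x ∉ K}) : RT V where
  r := b.r
  f v := if h : v ∈ K then (if (⟨v, h⟩ : {x // x ∈ K}) = a.r then b.r else a.f ⟨v, h⟩)
    else b.f ⟨v, h⟩
  d v := if h : v ∈ K then a.d ⟨v, h⟩ + 1 else b.d ⟨v, h⟩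
  hf := by
    have := b.r.2
    simp [this, b.hf]
  hd0 := by
    have := b.r.2
    simp [this, b.hd0]
  hd v hv := by
    by_cases h : v ∈ K
    · by_cases h2 : (⟨v, h⟩ : {x // x ∈ K}) = a.r
      · have := b.r.2
        simp [h, h2, this, a.hd0, b.hd0]
      · have := a.hd _ h2
        simp [h, h2, this]
    · have h2 : (⟨v, h⟩ : {x // x ∉ K}) ≠ b.r := fun h3 => hv (by rw [← h3])
      have h3 := b.hd _ h2
      have h4 := (b.f ⟨v, h⟩).2
      simp [h, h3, h4]

variable {K}
lemma glue_d_mem (a : RT {x // x ∈ K}) (b : RT {x // x ∉ K}) (v : {x // x ∈ K}) :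
    (glue K a b).d v = a.d v + 1 := by
  simp [glue]

lemma glue_d_not_mem (a : RT {x // x ∈ K}) (b : RT {x // x ∉ K}) (v : {x // x ∉ K}) :
    (glue K a b).d v = b.d v := by
  have := v.2
  simp [glue, this]

lemma glue_f_mem (a : RT {x // x ∈ K}) (b : RT {x // x ∉ K}) (v : {x // x ∈ K})
    (hv : v ≠ a.r) : (glue K a b).f v = a.f v := by
  simp [glue, hv]

lemma glue_f_not_mem (a : RT {x // x ∈ K}) (b : RT {x // x ∉ K}) (v : {x // x ∉ K}) :
    (glue K a b).f v = b.f v := by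
  have := v.2
  simp [glue, this]

lemma glue_Y [Fintype V] (a : RT {x // x ∈ K}) (b : RT {x // x ∉ K}) :
    (glue K a b).Y = K.card + a.Y + b.Y := by
  unfold Y
  rw [← Fintype.sum_subtype_add_sum_subtype (fun x => x ∈ K)]
  simp only [glue_d_mem, glue_d_not_mem, Finset.sum_add_distrib]
  simp
  ring_nf
  rw [add_comm]
  congr 1
  refine Finset.sum_congr ?_ (fun _ _ => rfl)
  ext
  simp

lemma glue_top_mem (a : RT {x // x ∈ K}) (b : RT {x // x ∉ K}) (v : {x // x ∈ K}) :
    (glue K a b).top v = a.r := by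
  obtain ⟨k, hk⟩ : ∃ k, a.d v = k := ⟨_, rfl⟩
  induction k generalizing v with
  | zero =>
    rw [top_of_d_one _ (by rw [glue_d_mem, hk])]
    rw [a.d_eq_zero.1 hk]
  | succ k ih =>
    have hv : v ≠ a.r := by
      intro h'
      rw [a.d_eq_zero.2 h'] at hk
      omega
    have h1 := a.hd v hv
    rw [← top_f _ (by rw [glue_d_mem]; omega), glue_f_mem _ _ _ hv]
    exact ih _ (by omega)

lemma glue_top_not_mem (a : RT {x // x ∈ K}) (b : RT {x // x ∉ K}) (v : {x // x ∉ K})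
    (h : v ≠ b.r) : (glue K a b).top v ∉ K := by
  obtain ⟨k, hk⟩ : ∃ k, b.d v = k + 1 := ⟨b.d (b.f v), b.hd v h⟩
  induction k generalizing v with
  | zero =>
    rw [top_of_d_one _ (by rw [glue_d_not_mem, hk])]
    exact v.2
  | succ k ih =>
    have h1 := b.hd v h
    rw [← top_f _ (by rw [glue_d_not_mem]; omega), glue_f_not_mem _ _ _]
    refine ih _ ?_ (by omega)
    intro h2
    rw [h2, b.hd0] at h1
    omega

lemma glue_inj {a a' : RT {x // x ∈ K}} {b b' : RT {x // x ∉ K}}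
    (h : glue K a b = glue K a' b') : a = a' ∧ b = b' := by
  have hd : ∀ v, (glue K a b).d v = (glue K a' b').d v := by rw [h]; simp
  have hf : ∀ v, (glue K a b).f v = (glue K a' b').f v := by rw [h]; simp
  have ha : a.d = a'.d := by
    funext v
    have := hd v
    rwa [glue_d_mem, glue_d_mem, Nat.add_right_cancel_iff] at this
  have hb : b.d = b'.d := by
    funext v
    have := hd v
    rwa [glue_d_not_mem, glue_d_not_mem] at this
  have har : a.r = a'.r := by rw [← a'.d_eq_zero, ← ha, a.hd0]
  have hbr : b.r = b'.r := by rw [← b'.d_eq_zero, ← hb, b.hd0]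
  constructor
  · refine RT.ext har ?_ ha
    funext v
    by_cases hv : v = a.r
    · rw [hv, a.hf, har, a'.hf]
    · have := hf v
      rw [glue_f_mem _ _ _ hv, glue_f_mem _ _ _ (by rwa [← har])] at this
      exact Subtype.ext this
  · refine RT.ext hbr ?_ hb
    funext v
    have := hf v
    rw [glue_f_not_mem, glue_f_not_mem] at this
    exact Subtype.ext this

/-- the branch containing v -/
def branch [Fintype V] (t : RT V) (v : V) : Finset V :=
  Finset.univ.filter (fun w => w ≠ t.r ∧ t.top w = t.top v)

lemma branch_glue [Fintype V] (a : RT {x // x ∈ K}) (b : RT {x // x ∉ K}) (v : {x // x ∈ K}) :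
    (glue K a b).branch v = K := by
  ext w
  simp only [branch, Finset.mem_filter, Finset.mem_univ, true_and, glue_top_mem]
  have hr : (glue K a b).r = b.r := rfl
  rw [hr]
  by_cases h : w ∈ K
  · have := glue_top_mem a b ⟨w, h⟩
    simp only [this, h, iff_true, and_true]
    rintro rfl
    exact b.r.2 h
  · simp only [h, iff_false, not_and]
    intro h2 h3
    have := glue_top_not_mem a b ⟨w, h⟩ (fun h4 => h2 (by rw [← h4]))
    simp only [h3] at this
    exact this a.r.2

lemma exists_glue [Fintype V] (t : RT V) (v : V) (hv : v ≠ t.r) (hK : t.branch v = K) :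
    ∃ a b, glue K a b = t := by
  have mem : ∀ w, w ∈ K ↔ w ≠ t.r ∧ t.top w = t.top v := by
    intro w
    rw [← hK]; simp [branch]
  have hdv : 1 ≤ t.d v := Nat.one_le_iff_ne_zero.2 (fun h => hv (t.d_eq_zero.1 h))
  have hc1 := t.d_top hdv
  have hcr : t.top v ≠ t.r := fun h => by rw [h, t.hd0] at hc1; omega
  have hcK : t.top v ∈ K := (mem _).2 ⟨hcr, t.top_of_d_one hc1⟩
  have hrK : t.r ∉ K := fun h => ((mem _).1 h).1 rfl
  have hfc : t.f (t.top v) = t.r := by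
    rw [← t.d_eq_zero]
    have := t.hd _ hcr
    omega
  have hfK : ∀ w ∈ K, w ≠ t.top v → t.f w ∈ K ∧ 2 ≤ t.d w := by
    intro w hw hwc
    obtain ⟨h1, h2⟩ := (mem w).1 hw
    have h3 := t.hd w h1
    have h4 : 2 ≤ t.d w := by
      by_contra h5
      have h6 : t.d w = 1 := by omega
      rw [t.top_of_d_one h6] at h2
      exact hwc h2
    refine ⟨(mem _).2 ⟨?_, by rw [t.top_f h4, h2]⟩, h4⟩
    intro h5
    rw [h5, t.hd0] at h3
    omega
  have hfnK : ∀ w ∉ K, t.f w ∉ K := by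
    intro w hw hfw
    obtain ⟨h1, h2⟩ := (mem _).1 hfw
    have hwr : w ≠ t.r := by
      rintro rfl
      exact h1 t.hf
    have h3 := t.hd w hwr
    have h4 : t.d (t.f w) ≠ 0 := fun h => h1 (t.d_eq_zero.1 h)
    exact hw ((mem w).2 ⟨hwr, by rw [← t.top_f (by omega), h2]⟩)
  let a : RT {x // x ∈ K} :=
    { r := ⟨t.top v, hcK⟩
      f := fun w => if h : w.1 = t.top v then w else ⟨t.f w, (hfK w w.2 h).1⟩
      d := fun w => t.d w - 1
      hf := by simp
      hd0 := by simp [hc1]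
      hd := by
        intro w hw
        have hw' : w.1 ≠ t.top v := fun h => hw (Subtype.ext h)
        have h1 := (hfK w w.2 hw').2
        have h2 := t.hd w ((mem _).1 w.2).1
        simp only [hw', dite_false]
        omega }
  let b : RT {x // x ∉ K} :=
    { r := ⟨t.r, hrK⟩
      f := fun w => ⟨t.f w, hfnK w w.2⟩
      d := fun w => t.d w
      hf := by simp [t.hf]
      hd0 := t.hd0
      hd := by
        intro w hw
        exact t.hd w (fun h => hw (Subtype.ext h)) }
  refine ⟨a, b, RT.ext rfl ?_ ?_⟩
  · funext w
    by_cases h : w ∈ K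
    · by_cases h2 : w = t.top v
      · subst h2
        simp [glue, h, a, b, hfc]
      · simp [glue, h, a, b, h2]
    · simp [glue, h, b]
  · funext w
    by_cases h : w ∈ K
    · have h2 := t.hd w ((mem _).1 h).1
      simp only [glue, h, a, dite_true]
      omega
    · simp [glue, h, b]

lemma sum_fiber [Fintype V] (K : Finset V) (F : ℕ → ℝ) :
    ∑ p : RT V × V with p.2 ≠ p.1.r ∧ p.1.branch p.2 = K, F p.1.Y =
    K.card * ∑ a : RT {x // x ∈ K}, ∑ b : RT {x // x ∉ K}, F (K.card + a.Y + b.Y) := by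
  have h1 : (K.card : ℝ) * ∑ a : RT {x // x ∈ K}, ∑ b : RT {x // x ∉ K}, F (K.card + a.Y + b.Y)
     = ∑ q : {x // x ∈ K} × RT {x // x ∈ K} × RT {x // x ∉ K}, F (K.card + q.2.1.Y + q.2.2.Y) := by
    rw [Fintype.sum_prod_type]
    simp only [Fintype.sum_prod_type]
    simp
  rw [h1]
  symm
  refine Finset.sum_bij (fun q _ => (glue K q.2.1 q.2.2, q.1.1)) ?_ ?_ ?_ ?_
  · rintro ⟨v, a, b⟩ -
    simp only [Finset.mem_filter, Finset.mem_univ, true_and]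
    refine ⟨?_, branch_glue a b v⟩
    intro h
    have : v.1 ∉ K := by rw [h]; exact b.r.2
    exact this v.2
  · rintro ⟨v, a, b⟩ - ⟨v', a', b'⟩ - h
    simp only [Prod.mk.injEq] at h
    obtain ⟨h1, h2⟩ := glue_inj h.1
    rw [h1, h2, Subtype.ext h.2]
  · rintro ⟨t, v⟩ h
    simp only [Finset.mem_filter, Finset.mem_univ, true_and] at h
    obtain ⟨a, b, hab⟩ := exists_glue t v h.1 h.2
    have hv : v ∈ K := by
      rw [← h.2]; simp [branch, h.1]
    exact ⟨(⟨v, hv⟩, a, b), Finset.mem_univ _, by simp [hab]⟩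
  · rintro ⟨v, a, b⟩ -
    simp [glue_Y]

lemma sum_rec [Fintype V] (F : ℕ → ℝ) :
    ((Fintype.card V : ℝ) - 1) * ∑ t : RT V, F t.Y =
    ∑ K : Finset V,
    K.card * ∑ a : RT {x // x ∈ K}, ∑ b : RT {x // x ∉ K}, F (K.card + a.Y + b.Y) := by
  simp only [← sum_fiber]
  have h := Finset.sum_fiberwise_of_maps_to (s := Finset.univ.filter (fun p : RT V × V => p.2 ≠ p.1.r))
    (t := (Finset.univ : Finset (Finset V))) (g := fun p => p.1.branch p.2) (fun _ _ => Finset.mem_univ _)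
    (fun p => F p.1.Y)
  simp only [Finset.filter_filter] at h
  rw [h, Finset.sum_filter, Fintype.sum_prod_type, Finset.mul_sum]
  refine Finset.sum_congr rfl fun t _ => ?_
  rw [← Finset.sum_filter]
  simp only []
  rw [Finset.sum_const, Finset.filter_ne', Finset.card_erase_of_mem (Finset.mem_univ _),
    Finset.card_univ, nsmul_eq_mul, Nat.cast_sub]
  · simp
  · exact Fintype.card_pos_iff.2 ⟨t.r⟩

end glue

/-- transport along an equivalence -/
def map {V W : Type} (e : V ≃ W) (t : RT V) : RT W where
  r := e t.r
  f w := e (t.f (e.symm w))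
  d w := t.d (e.symm w)
  hf := by simp [t.hf]
  hd0 := by simp [t.hd0]
  hd w hw := by
    have : e.symm w ≠ t.r := fun h => hw (by rw [← h]; simp)
    simp [t.hd _ this]

/-- transport along an equivalence -/
def mapEquiv {V W : Type} (e : V ≃ W) : RT V ≃ RT W where
  toFun := map e
  invFun := map e.symm
  left_inv t := by simp [map]
  right_inv t := by simp [map]

lemma sum_congr_card {V W : Type} [Fintype V] [Fintype W] (h : Fintype.card V = Fintype.card W)
    (F : ℕ → ℝ) : ∑ t : RT V, F t.Y = ∑ t : RT W, F t.Y := by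
  let e := Fintype.equivOfCardEq h
  refine Fintype.sum_equiv (mapEquiv e) _ _ fun t => ?_
  congr 1
  unfold Y
  exact Fintype.sum_equiv e _ _ (by simp [mapEquiv, map])

end RT

/-- sums over trees on `n` vertices -/
noncomputable def S (n : ℕ) (F : ℕ → ℝ) : ℝ := ∑ t : RT (Fin n), F t.Y

lemma S_rec (n : ℕ) (F : ℕ → ℝ) :
    ((n : ℝ) - 1) * S n F = ∑ k ∈ Finset.range (n + 1), (n.choose k : ℝ) *
      (k * S k (fun y => S (n - k) (fun z => F (k + y + z)))) := by
  have h := RT.sum_rec (V := Fin n) F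
  rw [Fintype.card_fin] at h
  unfold S
  rw [h]
  have h2 : ∀ K : Finset (Fin n), (K.card : ℝ) * ∑ a : RT {x // x ∈ K}, ∑ b : RT {x // x ∉ K},
      F (K.card + a.Y + b.Y) = (fun k : ℕ => (k * S k (fun y => S (n - k) (fun z => F (k + y + z))))) K.card := by
    intro K
    have h3 : ∀ y : ℕ, ∑ b : RT {x // x ∉ K}, F (K.card + y + b.Y) =
      S (n - K.card) (fun z => F (K.card + y + z)) := by
      intro y
      exact RT.sum_congr_card (by simp [Fintype.card_subtype_compl]) (fun z => F (K.card + y + z))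
    simp only [h3]
    congr 1
    exact RT.sum_congr_card (by simp) (fun y => S (n - K.card) (fun z => F (K.card + y + z)))
  rw [Finset.sum_congr rfl (fun K _ => h2 K)]
  have h4 := Finset.sum_powerset_apply_card (fun k : ℕ => (k * S k (fun y => S (n - k) (fun z => F (k + y + z)))))
    (x := (Finset.univ : Finset (Fin n)))
  simp only [Finset.powerset_univ, Finset.card_univ, Fintype.card_fin, nsmul_eq_mul] at h4
  rw [h4]
  rfl

lemma S_zero (F : ℕ → ℝ) : S 0 F = 0 := by
  unfold S
  have : IsEmpty (RT (Fin 0)) := ⟨fun t => t.r.elim0⟩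
  simp

lemma S_one (F : ℕ → ℝ) : S 1 F = F 1 := by
  unfold S
  have : Unique (RT (Fin 1)) :=
    { default := ⟨0, id, fun _ => 0, rfl, rfl, fun v hv => absurd (Subsingleton.elim _ _) hv⟩
      uniq := fun t => by
        have h1 : t.r = 0 := Subsingleton.elim _ _
        refine RT.ext h1 ?_ ?_
        · funext v; exact Subsingleton.elim _ _
        · funext v
          exact t.d_eq_zero.2 (Subsingleton.elim _ _) }
  rw [Fintype.sum_unique]
  congr 1
  simp only [RT.Y]
  simp
  exact (default : RT (Fin 1)).d_eq_zero.2 (Subsingleton.elim _ _)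
end TH

namespace TH
namespace RT
variable {V : Type}

/-- the underlying graph -/
def graph (t : RT V) : SimpleGraph V where
  Adj v w := v ≠ w ∧ (t.f v = w ∨ t.f w = v)
  symm := ⟨fun _ _ h => ⟨h.1.symm, h.2.symm⟩⟩
  loopless := ⟨fun _ h => h.1 rfl⟩

lemma graph_adj_f (t : RT V) {v : V} (hv : v ≠ t.r) : t.graph.Adj v (t.f v) := by
  refine ⟨fun h => ?_, Or.inl rfl⟩
  have := t.hd v hv
  rw [← h] at this
  omega

lemma exists_walk (t : RT V) (v : V) : ∃ p : t.graph.Walk v t.r, p.length = t.d v := by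
  obtain ⟨k, hk⟩ : ∃ k, t.d v = k := ⟨_, rfl⟩
  induction k generalizing v with
  | zero =>
    have := t.d_eq_zero.1 hk
    subst this
    exact ⟨SimpleGraph.Walk.nil, by simp [t.hd0]⟩
  | succ k ih =>
    have hv : v ≠ t.r := by
      intro h'
      rw [t.d_eq_zero.2 h'] at hk
      omega
    have h1 := t.hd v hv
    obtain ⟨p, hp⟩ := ih (t.f v) (by omega)
    exact ⟨SimpleGraph.Walk.cons (t.graph_adj_f hv) p, by simp [hp, h1]⟩

lemma d_adj (t : RT V) {v w : V} (h : t.graph.Adj v w) : t.d v = t.d w + 1 ∨ t.d w = t.d v + 1 := by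
  obtain ⟨h1, h2⟩ := h
  rcases h2 with h2 | h2
  · left
    by_cases hv : v = t.r
    · rw [hv, t.hf] at h2
      exact absurd (hv.trans h2) h1
    · rw [t.hd v hv, h2]
  · right
    by_cases hv : w = t.r
    · rw [hv, t.hf] at h2
      exact absurd (hv.trans h2) h1.symm
    · rw [t.hd w hv, h2]

lemma d_le_walk (t : RT V) {v w : V} (p : t.graph.Walk v w) : t.d v ≤ p.length + t.d w := by
  induction p with
  | nil => simp
  | cons h p ih =>
    have := t.d_adj h
    simp only [SimpleGraph.Walk.length_cons]
    omega

lemma graph_connected (t : RT V) : t.graph.Connected := by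
  have : Nonempty V := ⟨t.r⟩
  refine ⟨fun v w => ?_⟩
  obtain ⟨p, -⟩ := t.exists_walk v
  obtain ⟨q, -⟩ := t.exists_walk w
  exact ⟨p.append q.reverse⟩

lemma graph_dist (t : RT V) (v : V) : t.graph.dist v t.r = t.d v := by
  apply le_antisymm
  · obtain ⟨p, hp⟩ := t.exists_walk v
    rw [← hp]
    exact SimpleGraph.dist_le p
  · obtain ⟨p, hp⟩ := (t.graph_connected v t.r).exists_walk_length_eq_dist
    have := t.d_le_walk p
    rw [hp, t.hd0] at this
    simpa using this

lemma graph_isTree [Fintype V] [DecidableEq V] (t : RT V) : t.graph.IsTree := by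
  rw [SimpleGraph.isTree_iff_connected_and_card]
  refine ⟨t.graph_connected, ?_⟩
  apply le_antisymm
  · have h1 : t.graph.edgeSet ⊆ ((Finset.univ.erase t.r).image (fun v => s(v, t.f v)) : Finset (Sym2 V)) := by
      intro e he
      induction e with
      | h v w =>
        rw [SimpleGraph.mem_edgeSet] at he
        have h0 := he
        obtain ⟨h1, h2⟩ := he
        simp only [Finset.coe_image, Set.mem_image, Finset.mem_coe, Finset.mem_erase,
          Finset.mem_univ, and_true]
        rcases h2 with h2 | h2
        · refine ⟨v, ?_, by rw [h2]⟩
          rintro rfl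
          rw [t.hf] at h2
          exact h1 h2
        · refine ⟨w, ?_, by rw [h2, Sym2.eq_swap]⟩
          rintro rfl
          rw [t.hf] at h2
          exact h1 h2.symm
    have h2 := Nat.card_mono (Finset.finite_toSet _) h1
    rw [Nat.card_coe_set_eq, Nat.card_coe_set_eq, Set.ncard_coe_finset] at h2
    have h3 : ((Finset.univ.erase t.r).image (fun v => s(v, t.f v)) : Finset (Sym2 V)).card ≤
      Fintype.card V - 1 := by
      refine Finset.card_image_le.trans ?_
      rw [Finset.card_erase_of_mem (Finset.mem_univ _), Finset.card_univ]
    have h4 : 0 < Fintype.card V := Fintype.card_pos_iff.2 ⟨t.r⟩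
    rw [Nat.card_eq_fintype_card (α := V), Nat.card_coe_set_eq]
    omega
  · exact t.graph_connected.card_vert_le_card_edgeSet_add_one

lemma graph_inj (s t : RT V) (hg : s.graph = t.graph) (hr : s.r = t.r) : s = t := by
  have hd : s.d = t.d := by
    funext v
    rw [← graph_dist, ← graph_dist, hg, hr]
  refine RT.ext hr ?_ hd
  funext v
  by_cases hv : v = s.r
  · rw [hv, s.hf, hr, t.hf]
  · have h1 := s.graph_adj_f hv
    have h2 := s.hd v hv
    rw [hg] at h1
    obtain ⟨h3, h4 | h4⟩ := h1
    · exact h4.symm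
    · exfalso
      have : s.f v ≠ t.r := by
        intro h5
        rw [h5, t.hf] at h4
        exact hv (by rw [← h4, hr])
      have h6 := t.hd _ this
      rw [h4, ← hd] at h6
      omega

lemma exists_graph [Fintype V] [DecidableEq V] (G : SimpleGraph V) (hG : G.IsTree) (r : V) :
    ∃ t : RT V, t.graph = G ∧ t.r = r := by
  have hex : ∀ v, ∃ w, (v = r → w = r) ∧ (v ≠ r → G.Adj v w ∧ G.dist v r = G.dist w r + 1) := by
    intro v
    by_cases hv : v = r
    · exact ⟨r, fun _ => rfl, fun h => absurd hv h⟩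
    · obtain ⟨p, hp⟩ := (hG.1 v r).exists_walk_length_eq_dist
      cases p with
      | nil => exact absurd rfl hv
      | @cons _ w _ h q =>
        refine ⟨w, fun h => absurd h hv, fun _ => ⟨h, ?_⟩⟩
        simp only [SimpleGraph.Walk.length_cons] at hp
        have h1 := SimpleGraph.dist_le q
        have h2 := SimpleGraph.IsTree.dist_eq_dist_add_one_of_adj hG r h
        rw [SimpleGraph.dist_comm (u := r) (v := v), SimpleGraph.dist_comm (u := r) (v := w)] at h2
        omega
  choose f hf using hex
  let t : RT V :=
    { r := r
      f := f
      d := fun v => G.dist v r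
      hf := (hf r).1 rfl
      hd0 := by simp
      hd := fun v hv => ((hf v).2 hv).2 }
  refine ⟨t, ?_, rfl⟩
  have hle : t.graph ≤ G := by
    intro v w h
    obtain ⟨h1, h2 | h2⟩ := h
    · by_cases hv : v = r
      · exact absurd (hv.trans (((hf v).1 hv).symm.trans h2)) h1
      · have := ((hf v).2 hv).1
        rwa [show f v = w from h2] at this
    · by_cases hv : w = r
      · exact absurd (hv.trans (((hf w).1 hv).symm.trans h2)) h1.symm
      · have := ((hf w).2 hv).1
        rw [show f w = v from h2] at this
        exact this.symm
  have hmin := SimpleGraph.isTree_iff_minimal_connected.1 hG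
  exact le_antisymm hle (hmin.2 t.graph_connected hle)
end RT

lemma sum_trees (n : ℕ) (F : ℕ → ℝ) :
    ∑ p ∈ RootedLabeledTrees n, F (rlTotalHeight n p + n) = S n F := by
  unfold S
  symm
  refine Finset.sum_bij (fun t _ => (t.graph, t.r)) ?_ ?_ ?_ ?_
  · intro t _
    simp [RootedLabeledTrees, t.graph_isTree]
  · intro s _ t _ h
    simp only [Prod.mk.injEq] at h
    exact RT.graph_inj s t h.1 h.2
  · rintro ⟨G, r⟩ h
    simp only [RootedLabeledTrees, Finset.mem_filter, Finset.mem_univ, true_and] at h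
    obtain ⟨t, h1, h2⟩ := RT.exists_graph G h r
    exact ⟨t, Finset.mem_univ _, by rw [h1, h2]⟩
  · intro t _
    congr 1
    simp [rlTotalHeight, RT.Y, RT.graph_dist, Finset.sum_add_distrib]

lemma card_trees (n : ℕ) : ((RootedLabeledTrees n).card : ℝ) = S n (fun _ => 1) := by
  rw [← sum_trees]
  simp
end TH

set_option maxHeartbeats 1000000

namespace TH
open PowerSeries

/-- Euler derivation -/
noncomputable def th : Derivation ℝ ℝ⟦X⟧ ℝ⟦X⟧ := (X : ℝ⟦X⟧) • PowerSeries.derivative ℝ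

lemma coeff_th (f : ℝ⟦X⟧) (n : ℕ) : coeff n (th f) = n * coeff n f := by
  have : th f = X * PowerSeries.derivative ℝ f := rfl
  rw [this]
  cases n with
  | zero => simp
  | succ n =>
    rw [mul_comm X, PowerSeries.coeff_succ_mul_X, PowerSeries.coeff_derivative]
    push_cast
    ring

lemma uniq (D E : ℝ⟦X⟧) (hE : constantCoeff E = 1) (h : th D = E * D)
    (h1 : coeff 1 D = 0) : D = 0 := by
  ext n
  induction n using Nat.strong_induction_on with
  | _ n ih =>
    have h2 := congrArg (coeff n) h
    rw [coeff_th, coeff_mul, Finset.sum_eq_single (0, n)] at h2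
    · simp only [coeff_zero_eq_constantCoeff, hE, one_mul] at h2
      by_cases hn : n = 1
      · rw [hn, h1]; simp
      · have : ((n : ℝ) - 1) * coeff n D = 0 := by linarith
        rcases mul_eq_zero.1 this with h3 | h3
        · exfalso
          apply hn
          have : (n : ℝ) = 1 := by linarith
          exact_mod_cast this
        · rw [h3]; simp
    · rintro ⟨i, j⟩ hij hne
      rw [Finset.HasAntidiagonal.mem_antidiagonal] at hij
      simp only at hij
      have : j < n := by
        rcases Nat.eq_zero_or_pos i with hi | hi
        · exfalso
          apply hne
          rw [hi] at hij ⊢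
          simp at hij
          rw [hij]
        · omega
      rw [ih j this]
      simp
    · intro h; simp at h

/-- exponential generating function of the moments -/
noncomputable def W (j : ℕ) : ℝ⟦X⟧ := PowerSeries.mk fun n => S n (fun y => (y : ℝ) ^ j) / (n.factorial : ℝ)

lemma coeff_W (j n : ℕ) : coeff n (W j) = S n (fun y => (y : ℝ) ^ j) / (n.factorial : ℝ) := by
  simp [W]

lemma coeff_lhs (j n : ℕ) : coeff n (th (W j) - W j) =
    ∑ p ∈ Finset.HasAntidiagonal.antidiagonal n, (p.1 / (p.1.factorial * p.2.factorial : ℝ)) *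
      S p.1 (fun y => S p.2 (fun z => ((p.1 : ℝ) + y + z) ^ j)) := by
  rw [map_sub, coeff_th, coeff_W]
  have h := S_rec n (fun y => (y : ℝ) ^ j)
  have h2 : (n : ℝ) * (S n (fun y => (y : ℝ) ^ j) / (n.factorial : ℝ)) -
      (S n (fun y => (y : ℝ) ^ j) / (n.factorial : ℝ)) =
      (((n : ℝ) - 1) * S n (fun y => (y : ℝ) ^ j)) / (n.factorial : ℝ) := by ring
  rw [h2, h, Finset.Nat.sum_antidiagonal_eq_sum_range_succ_mk, Finset.sum_div]
  refine Finset.sum_congr rfl fun k hk => ?_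
  have hk' : k ≤ n := by
    rw [Finset.mem_range] at hk; omega
  rw [Nat.cast_choose ℝ hk']
  have := Nat.factorial_ne_zero n
  push_cast
  field_simp

lemma sum_expand3 (k l : ℕ) : S k (fun y => S l (fun z => ((k : ℝ) + y + z) ^ 3)) =
    (k ^ 3 * S k (fun y => (y : ℝ) ^ 0) + 3 * k ^ 2 * S k (fun y => (y : ℝ) ^ 1) +
      3 * k * S k (fun y => (y : ℝ) ^ 2) + S k (fun y => (y : ℝ) ^ 3)) * S l (fun z => (z : ℝ) ^ 0) +
    3 * (k ^ 2 * S k (fun y => (y : ℝ) ^ 0) + 2 * k * S k (fun y => (y : ℝ) ^ 1) +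
      S k (fun y => (y : ℝ) ^ 2)) * S l (fun z => (z : ℝ) ^ 1) +
    3 * (k * S k (fun y => (y : ℝ) ^ 0) + S k (fun y => (y : ℝ) ^ 1)) * S l (fun z => (z : ℝ) ^ 2) +
    S k (fun y => (y : ℝ) ^ 0) * S l (fun z => (z : ℝ) ^ 3) := by
  simp only [S, Finset.mul_sum, Finset.sum_mul, ← Finset.sum_add_distrib]
  rw [Finset.sum_comm]
  refine Finset.sum_congr rfl fun a _ => Finset.sum_congr rfl fun b _ => ?_
  ring

lemma sum_expand2 (k l : ℕ) : S k (fun y => S l (fun z => ((k : ℝ) + y + z) ^ 2)) =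
    (k ^ 2 * S k (fun y => (y : ℝ) ^ 0) + 2 * k * S k (fun y => (y : ℝ) ^ 1) +
      S k (fun y => (y : ℝ) ^ 2)) * S l (fun z => (z : ℝ) ^ 0) +
    2 * (k * S k (fun y => (y : ℝ) ^ 0) + S k (fun y => (y : ℝ) ^ 1)) * S l (fun z => (z : ℝ) ^ 1) +
    S k (fun y => (y : ℝ) ^ 0) * S l (fun z => (z : ℝ) ^ 2) := by
  simp only [S, Finset.mul_sum, Finset.sum_mul, ← Finset.sum_add_distrib]
  rw [Finset.sum_comm]
  refine Finset.sum_congr rfl fun a _ => Finset.sum_congr rfl fun b _ => ?_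
  ring

lemma sum_expand1 (k l : ℕ) : S k (fun y => S l (fun z => ((k : ℝ) + y + z) ^ 1)) =
    (k * S k (fun y => (y : ℝ) ^ 0) + S k (fun y => (y : ℝ) ^ 1)) * S l (fun z => (z : ℝ) ^ 0) +
    S k (fun y => (y : ℝ) ^ 0) * S l (fun z => (z : ℝ) ^ 1) := by
  simp only [S, Finset.mul_sum, Finset.sum_mul, ← Finset.sum_add_distrib]
  rw [Finset.sum_comm]
  refine Finset.sum_congr rfl fun a _ => Finset.sum_congr rfl fun b _ => ?_
  ring

lemma sum_expand0 (k l : ℕ) : S k (fun y => S l (fun z => ((k : ℝ) + y + z) ^ 0)) =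
    S k (fun y => (y : ℝ) ^ 0) * S l (fun z => (z : ℝ) ^ 0) := by
  simp only [S, Finset.mul_sum, Finset.sum_mul]
  rw [Finset.sum_comm]
  refine Finset.sum_congr rfl fun a _ => Finset.sum_congr rfl fun b _ => ?_
  ring

lemma ode0 : th (W 0) - W 0 = th (W 0) * W 0 := by
  ext n
  rw [coeff_lhs]
  simp only [coeff_mul]
  refine Finset.sum_congr rfl fun p _ => ?_
  rw [sum_expand0]
  simp only [coeff_th, coeff_W, coeff_smul, map_add, smul_eq_mul]
  field_simp

lemma ode1 : th (W 1) - W 1 = th (th (W 0) + W 1) * W 0 + th (W 0) * W 1 := by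
  ext n
  rw [coeff_lhs]
  simp only [map_add, coeff_mul, ← Finset.sum_add_distrib]
  refine Finset.sum_congr rfl fun p _ => ?_
  rw [sum_expand1]
  simp only [coeff_th, coeff_W, coeff_smul, map_add, smul_eq_mul]
  field_simp

lemma ode2 : th (W 2) - W 2 = th (th (th (W 0)) + (2 : ℝ) • th (W 1) + W 2) * W 0 +
    (2 : ℝ) • (th (th (W 0) + W 1) * W 1) + th (W 0) * W 2 := by
  ext n
  rw [coeff_lhs]
  simp only [map_add, coeff_mul, Finset.mul_sum, ← Finset.sum_add_distrib, smul_eq_mul, map_smul]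
  refine Finset.sum_congr rfl fun p _ => ?_
  rw [sum_expand2]
  simp only [coeff_th, coeff_W, coeff_smul, map_add, smul_eq_mul]
  field_simp

lemma ode3 : th (W 3) - W 3 =
    th (th (th (th (W 0))) + (3 : ℝ) • th (th (W 1)) + (3 : ℝ) • th (W 2) + W 3) * W 0 +
    (3 : ℝ) • (th (th (th (W 0)) + (2 : ℝ) • th (W 1) + W 2) * W 1) +
    (3 : ℝ) • (th (th (W 0) + W 1) * W 2) + th (W 0) * W 3 := by
  ext n
  rw [coeff_lhs]
  simp only [map_add, coeff_mul, Finset.mul_sum, ← Finset.sum_add_distrib, smul_eq_mul, map_smul]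
  refine Finset.sum_congr rfl fun p _ => ?_
  rw [sum_expand3]
  simp only [coeff_th, coeff_W, coeff_smul, map_add, smul_eq_mul]
  field_simp

lemma W_c0 (j : ℕ) : constantCoeff (W j) = 0 := by
  rw [← coeff_zero_eq_constantCoeff_apply, coeff_W, S_zero]; simp

lemma W_c1 (j : ℕ) : coeff 1 (W j) = 1 := by
  rw [coeff_W, S_one]; simp

/-- 1/(1-T) -/
noncomputable def u : ℝ⟦X⟧ := (1 - W 0)⁻¹

lemma u_mul : u * (1 - W 0) = 1 := by
  unfold u
  apply PowerSeries.inv_mul_cancel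
  simp [W_c0]

lemma u_c0 : constantCoeff u = 1 := by
  have := congrArg (constantCoeff (R := ℝ)) u_mul
  simpa [W_c0] using this

lemma W0_u : W 0 * u = u - 1 := by
  linear_combination (-1 : ℝ⟦X⟧) * u_mul

lemma th_W0 : th (W 0) = u - 1 := by
  have h := ode0
  linear_combination u * h - (th (W 0)) * u_mul + W0_u

lemma th_u : th u = u ^ 3 - u ^ 2 := by
  have h := congrArg th u_mul
  rw [Derivation.leibniz, map_sub, Derivation.map_one_eq_zero, th_W0] at h
  simp only [smul_eq_mul] at h
  linear_combination u * h - (th u) * u_mul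

lemma th_upow (i : ℕ) : th (u ^ (i + 1)) = ((i : ℝ) + 1) • (u ^ (i + 3) - u ^ (i + 2)) := by
  rw [Derivation.leibniz_pow, th_u]
  simp only [Nat.add_sub_cancel, smul_eq_mul]
  rw [← Nat.cast_smul_eq_nsmul ℝ]
  push_cast
  congr 1
  ring

lemma two_smul_ps (f : ℝ⟦X⟧) : (2 : ℝ) • f = 2 * f := by
  rw [Algebra.smul_def, map_ofNat]

lemma three_smul_ps (f : ℝ⟦X⟧) : (3 : ℝ) • f = 3 * f := by
  rw [Algebra.smul_def, map_ofNat]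

lemma th_num_mul (n : ℕ) (f : ℝ⟦X⟧) : th ((n : ℝ⟦X⟧) * f) = n * th f := by
  rw [Derivation.leibniz]
  simp

lemma uniq_W (j : ℕ) (P C Q R : ℝ⟦X⟧) (hC : C = (u - 1) * P) (hP : constantCoeff P = 1)
    (h1 : th (W j) - W j = th (W j) * W 0 + th (W 0) * W j + Q * W 0 + R)
    (h2 : u * (th C - C) = th C * (u - 1) + u * ((u - 1) * C) + Q * (u - 1) + u * R) : W j = C := by
  rw [← sub_eq_zero]
  apply uniq _ (u ^ 2)
  · simp [u_c0]
  · rw [map_sub]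
    rw [th_W0] at h1
    linear_combination u * h1 - h2 + (th (W j) + Q) * W0_u
  · have : coeff 1 (W 0 * (u * P)) = 1 := by
      rw [coeff_mul, Finset.Nat.antidiagonal_succ]
      simp [W_c0, W_c1, hP, u_c0]
    rw [← mul_assoc, W0_u] at this
    rw [map_sub, W_c1, hC, this, sub_self]

lemma W1_eq : W 1 = u ^ 2 - u := by
  apply uniq_W 1 u _ (th (th (W 0))) 0
  · ring
  · simp [u_c0]
  · rw [ode1, map_add]; ring
  · simp only [th_W0, map_sub, Derivation.leibniz_pow, Derivation.map_one_eq_zero, th_u, nsmul_eq_mul, smul_eq_mul]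
    push_cast
    ring

lemma W2_eq : W 2 = 5 * u ^ 5 - 10 * u ^ 4 + 6 * u ^ 3 - u ^ 2 := by
  apply uniq_W 2 (5 * u ^ 4 - 5 * u ^ 3 + u ^ 2) _ (th (th (th (W 0)) + (2 : ℝ) • th (W 1)))
    ((2 : ℝ) • (th (th (W 0) + W 1) * W 1))
  · ring
  · simp [u_c0]
  · rw [ode2, map_add]; ring
  · have h5 := th_num_mul 5
    have h10 := th_num_mul 10
    have h6 := th_num_mul 6
    have h2 : th (2 : ℝ⟦X⟧) = 0 := th.map_natCast 2
    push_cast at h5 h10 h6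
    simp only [W1_eq, two_smul_ps, th_W0, map_sub, map_add, Derivation.leibniz_pow, Derivation.leibniz, h5, h10, h6, h2,
      Derivation.map_one_eq_zero, map_zero, Derivation.map_natCast, th_u, nsmul_eq_mul, smul_eq_mul]
    push_cast
    ring

lemma W3_eq : W 3 = 90 * u ^ 8 - 278 * u ^ 7 + 317 * u ^ 6 - 161 * u ^ 5 + 34 * u ^ 4 - 2 * u ^ 3 := by
  apply uniq_W 3 (90 * u ^ 7 - 188 * u ^ 6 + 129 * u ^ 5 - 32 * u ^ 4 + 2 * u ^ 3) _
    (th (th (th (th (W 0))) + (3 : ℝ) • th (th (W 1)) + (3 : ℝ) • th (W 2)))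
    ((3 : ℝ) • (th (th (th (W 0)) + (2 : ℝ) • th (W 1) + W 2) * W 1) +
    (3 : ℝ) • (th (th (W 0) + W 1) * W 2))
  · ring
  · simp [u_c0, map_ofNat]; norm_num
  · rw [ode3, map_add]; ring
  · have hn : ∀ n : ℕ, th (n : ℝ⟦X⟧) = 0 := fun n => th.map_natCast n
    have h2 := hn 2
    have h3 := hn 3
    have h5 := hn 5
    have h10 := hn 10
    have h6 := hn 6
    have h90 := hn 90
    have h278 := hn 278
    have h317 := hn 317
    have h161 := hn 161
    have h34 := hn 34
    push_cast at h2 h3 h5 h10 h6 h90 h278 h317 h161 h34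
    simp only [W1_eq, W2_eq, two_smul_ps, three_smul_ps, th_W0, map_sub, map_add, Derivation.leibniz_pow, Derivation.leibniz,
      h2, h3, h5, h10, h6, h90, h278, h317, h161, h34,
      Derivation.map_one_eq_zero, map_zero, Derivation.map_natCast, th_u, nsmul_eq_mul, smul_eq_mul]
    push_cast
    ring

end TH

namespace TH
open PowerSeries

lemma appell_unique (A B : ℕ → ℝ → ℝ)
    (hA : ∀ n y, HasDerivAt (A (n + 1)) ((n + 1) * A n (y + 1)) y)
    (hB : ∀ n y, HasDerivAt (B (n + 1)) ((n + 1) * B n (y + 1)) y)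
    (h0 : ∀ y, A 0 y = B 0 y) (h : ∀ n : ℕ, A (n + 1) (-((n : ℝ) + 1)) = B (n + 1) (-((n : ℝ) + 1))) :
    ∀ n y, A n y = B n y := by
  intro n
  induction n with
  | zero => exact h0
  | succ n ih =>
    intro y
    have hd : ∀ y, HasDerivAt (fun y => A (n + 1) y - B (n + 1) y) 0 y := by
      intro y
      have := (hA n y).sub (hB n y)
      rw [ih, sub_self] at this
      exact this
    have := is_const_of_deriv_eq_zero (fun y => (hd y).differentiableAt) (fun y => (hd y).deriv)
      y (-((n : ℝ) + 1))
    simp only [h n, sub_self] at this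
    linarith

/-- binomial convolution with shifted powers -/
noncomputable def AA (a : ℕ → ℝ) (n : ℕ) (y : ℝ) : ℝ :=
  ∑ k ∈ Finset.range (n + 1), (n.choose k : ℝ) * a k * (y + ((n - k : ℕ) : ℝ)) ^ (n - k)

lemma AA_deriv (a : ℕ → ℝ) (n : ℕ) (y : ℝ) :
    HasDerivAt (AA a (n + 1)) ((n + 1) * AA a n (y + 1)) y := by
  have h : ∀ k ∈ Finset.range (n + 2), HasDerivAt
      (fun y : ℝ => ((n + 1).choose k : ℝ) * a k * (y + ((n + 1 - k : ℕ) : ℝ)) ^ (n + 1 - k))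
      (((n + 1).choose k : ℝ) * a k * (((n + 1 - k : ℕ) : ℝ) * (y + ((n + 1 - k : ℕ) : ℝ)) ^ (n + 1 - k - 1))) y := by
    intro k _
    apply HasDerivAt.const_mul
    have := ((hasDerivAt_id y).add_const ((n + 1 - k : ℕ) : ℝ)).fun_pow (n + 1 - k)
    simpa using this
  have h2 := HasDerivAt.fun_sum h
  unfold AA
  refine h2.congr_deriv (Eq.symm ?_)
  rw [Finset.sum_range_succ _ (n + 1)]
  simp only [Nat.sub_self, Nat.cast_zero, zero_mul, mul_zero, add_zero]
  rw [Finset.mul_sum]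
  refine Finset.sum_congr rfl fun k hk => ?_
  have hk' : k ≤ n := by rw [Finset.mem_range] at hk; omega
  obtain ⟨m, rfl⟩ := Nat.exists_eq_add_of_le hk'
  have e1 : k + m + 1 - k = m + 1 := by omega
  have e2 : k + m - k = m := by omega
  have e3 := Nat.choose_mul_succ_eq (k + m) k
  rw [e1] at e3
  have e4 : ((k + m).choose k : ℝ) * ((k : ℝ) + m + 1) = ((k + m + 1).choose k : ℝ) * ((m : ℝ) + 1) := by
    exact_mod_cast e3
  rw [e1, e2, Nat.add_sub_cancel]
  push_cast
  have e5 : y + 1 + (m : ℝ) = y + (m + 1) := by ring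
  rw [e5]
  linear_combination (a k * (y + (m + 1)) ^ m) * e4

lemma alt_sum (n j : ℕ) : ∑ k ∈ Finset.range (n + 1), ((-1 : ℝ)) ^ (n - k) * (n.choose k : ℝ) * (k : ℝ) ^ j =
    (fwdDiff (1 : ℝ))^[n] (fun x => x ^ j) 0 := by
  rw [fwdDiff_iter_eq_sum_shift]
  refine Finset.sum_congr rfl fun k _ => ?_
  simp

/-- the sequence k^(k-1) -/
noncomputable def tk (k : ℕ) : ℝ := if k = 0 then 0 else (k : ℝ) ^ (k - 1)

lemma abel1 (n : ℕ) (y : ℝ) : AA tk n y = n * (y + n) ^ (n - 1) := by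
  refine appell_unique (AA tk) (fun n y => n * (y + n) ^ (n - 1)) (AA_deriv tk) ?_ ?_ ?_ n y
  · intro n y
    have := (((hasDerivAt_id y).add_const ((n + 1 : ℕ) : ℝ)).fun_pow n).const_mul ((n : ℝ) + 1)
    simp only [id, mul_one, Nat.cast_add, Nat.cast_one] at this
    simp only [Nat.cast_add, Nat.cast_one, Nat.add_sub_cancel]
    refine this.congr_deriv (Eq.symm ?_)
    rw [show y + 1 + (n : ℝ) = y + (n + 1) by ring]
  · intro y
    simp [AA, tk]
  · intro n
    simp only [Nat.add_sub_cancel]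
    have h : AA tk (n + 1) (-((n : ℝ) + 1)) = ∑ k ∈ Finset.range (n + 1 + 1), ((-1 : ℝ)) ^ (n + 1 - k) *
        ((n + 1).choose k : ℝ) * (if k = 0 then 0 else (k : ℝ) ^ n) := by
      unfold AA
      refine Finset.sum_congr rfl fun k hk => ?_
      have hk' : k ≤ n + 1 := by rw [Finset.mem_range] at hk; omega
      unfold tk
      split_ifs with h0
      · simp
      · obtain ⟨l, rfl⟩ : ∃ l, k = l + 1 := ⟨k - 1, by omega⟩
        obtain ⟨m, rfl⟩ : ∃ m, n = l + m := ⟨n - l, by omega⟩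
        have e1 : l + m + 1 - (l + 1) = m := by omega
        rw [e1, Nat.add_sub_cancel]
        push_cast
        have e2 : -((l : ℝ) + m + 1) + m = (-1) * (l + 1) := by ring
        rw [e2, mul_pow, pow_add]
        ring
    rw [h]
    rcases Nat.eq_zero_or_pos n with hn | hn
    · subst hn
      simp [Finset.sum_range_succ]
    · have h2 : ∀ k : ℕ, (if k = 0 then (0 : ℝ) else (k : ℝ) ^ n) = (k : ℝ) ^ n := by
        intro k
        split_ifs with h0
        · rw [h0, Nat.cast_zero, zero_pow (by omega)]
        · rfl
      simp only [h2]
      rw [alt_sum, fwdDiff_iter_pow_eq_zero_of_lt (by omega)]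
      have : -((n : ℝ) + 1) + ((n + 1 : ℕ) : ℝ) = 0 := by push_cast; ring
      rw [this, zero_pow (by omega)]
      simp

lemma abel2 (n : ℕ) (y : ℝ) : AA (fun k => (k : ℝ) ^ k) n y =
    ∑ j ∈ Finset.range (n + 1), (n.factorial : ℝ) / j.factorial * (y + n) ^ j := by
  refine appell_unique (AA _) (fun n y => ∑ j ∈ Finset.range (n + 1), (n.factorial : ℝ) / j.factorial * (y + n) ^ j)
    (AA_deriv _) ?_ ?_ ?_ n y
  · intro n y
    have h : ∀ j ∈ Finset.range (n + 1 + 1), HasDerivAt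
      (fun y : ℝ => ((n + 1).factorial : ℝ) / j.factorial * (y + ((n + 1 : ℕ) : ℝ)) ^ j)
      (((n + 1).factorial : ℝ) / j.factorial * (j * (y + ((n + 1 : ℕ) : ℝ)) ^ (j - 1))) y := by
      intro j _
      apply HasDerivAt.const_mul
      have := ((hasDerivAt_id y).add_const ((n + 1 : ℕ) : ℝ)).fun_pow j
      simpa using this
    have h2 := HasDerivAt.fun_sum h
    refine h2.congr_deriv (Eq.symm ?_)
    rw [Finset.sum_range_succ' _ (n + 1)]
    simp only [Nat.cast_zero, zero_mul, mul_zero, add_zero]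
    rw [Finset.mul_sum]
    refine Finset.sum_congr rfl fun k hk => ?_
    rw [Nat.factorial_succ, Nat.factorial_succ, Nat.add_sub_cancel]
    push_cast
    have e5 : y + 1 + (n : ℝ) = y + (n + 1) := by ring
    rw [e5]
    field_simp
  · intro y
    simp [AA]
  · intro n
    have h : AA (fun k => (k : ℝ) ^ k) (n + 1) (-((n : ℝ) + 1)) = ∑ k ∈ Finset.range (n + 1 + 1), ((-1 : ℝ)) ^ (n + 1 - k) *
        ((n + 1).choose k : ℝ) * ((k : ℝ) ^ (n + 1)) := by
      unfold AA
      refine Finset.sum_congr rfl fun k hk => ?_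
      have hk' : k ≤ n + 1 := by rw [Finset.mem_range] at hk; omega
      have e2 : -((n : ℝ) + 1) + ((n + 1 - k : ℕ) : ℝ) = (-1) * k := by
        push_cast [Nat.cast_sub hk']; ring
      rw [e2, mul_pow, show (k : ℝ) ^ (n + 1) = (k : ℝ) ^ k * (k : ℝ) ^ (n + 1 - k) by rw [← pow_add]; congr 1; omega]
      ring
    rw [h, alt_sum, fwdDiff_iter_eq_factorial, Finset.sum_range_succ']
    have : -((n : ℝ) + 1) + ((n + 1 : ℕ) : ℝ) = 0 := by push_cast; ring
    simp [this]

/-- candidate for u -/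
noncomputable def P : ℝ⟦X⟧ := PowerSeries.mk fun n => (n : ℝ) ^ n / n.factorial

/-- candidate for T -/
noncomputable def T0 : ℝ⟦X⟧ := PowerSeries.mk fun n => tk n / n.factorial

lemma conv_eq (a : ℕ → ℝ) (n : ℕ) :
    coeff n ((PowerSeries.mk fun n => a n / n.factorial) * P) = AA a n 0 / n.factorial := by
  rw [coeff_mul, Finset.Nat.sum_antidiagonal_eq_sum_range_succ_mk, AA, Finset.sum_div]
  refine Finset.sum_congr rfl fun k hk => ?_
  have hk' : k ≤ n := by rw [Finset.mem_range] at hk; omega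
  rw [Nat.cast_choose ℝ hk']
  simp only [P, coeff_mk, zero_add]
  have := Nat.factorial_ne_zero n
  field_simp

lemma T0_P : T0 * P = P - 1 := by
  ext n
  rw [T0, conv_eq, abel1, map_sub, P, coeff_mk, coeff_one]
  cases n with
  | zero => simp
  | succ n =>
    simp
    ring

lemma th_T0 : th T0 = P - 1 := by
  ext n
  rw [coeff_th, map_sub, T0, P, coeff_mk, coeff_mk, coeff_one, tk]
  cases n with
  | zero => simp
  | succ n =>
    simp
    ring

lemma W0_eq : W 0 = T0 := by
  rw [← sub_eq_zero]
  apply uniq _ (P * u)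
  · have : constantCoeff P = 1 := by
      rw [← coeff_zero_eq_constantCoeff_apply, P, coeff_mk]; simp
    simp [u_c0, this]
  · rw [map_sub, th_T0, th_W0]
    linear_combination u * T0_P - P * W0_u
  · rw [map_sub, W_c1, T0, coeff_mk]
    simp [tk]

lemma u_eq : u = P := by
  have h1 := th_W0
  rw [W0_eq, th_T0] at h1
  linear_combination -h1

lemma card_eq (n : ℕ) : S n (fun y => (y : ℝ) ^ 0) = tk n := by
  have h := coeff_W 0 n
  rw [W0_eq, T0, coeff_mk] at h
  have := Nat.factorial_ne_zero n
  field_simp at h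
  simpa using h.symm

/-- normalised coefficients of u^i -/
noncomputable def c (i n : ℕ) : ℝ := coeff n (u ^ i) * n.factorial

lemma c_one (n : ℕ) : c 1 n = (n : ℝ) ^ n := by
  have := Nat.factorial_ne_zero n
  rw [c, pow_one, u_eq, P, coeff_mk]
  field_simp

lemma c_two (n : ℕ) : c 2 n = ∑ j ∈ Finset.range (n + 1), (n.factorial : ℝ) / j.factorial * (n : ℝ) ^ j := by
  have := Nat.factorial_ne_zero n
  rw [c, pow_two, u_eq]
  have h := conv_eq (fun k => (k : ℝ) ^ k) n
  rw [abel2] at h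
  rw [show P * P = (PowerSeries.mk fun n => (n : ℝ) ^ n / n.factorial) * P from rfl, h]
  simp only [zero_add]
  field_simp

lemma c_rec (i n : ℕ) : c (i + 3) n = c (i + 2) n + n / (i + 1) * c (i + 1) n := by
  have h := congrArg (coeff n) (th_upow i)
  rw [coeff_th, coeff_smul, map_sub, smul_eq_mul] at h
  unfold c
  have : (i : ℝ) + 1 ≠ 0 := by positivity
  field_simp
  linear_combination -h

lemma S1_eq (n : ℕ) : S n (fun y => (y : ℝ) ^ 1) = c 2 n - c 1 n := by
  have h := coeff_W 1 n
  have := Nat.factorial_ne_zero n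
  rw [eq_div_iff (by positivity)] at h
  rw [← h, W1_eq]
  simp only [c, map_sub, pow_one]
  ring

lemma S2_eq (n : ℕ) : S n (fun y => (y : ℝ) ^ 2) = 5 * c 5 n - 10 * c 4 n + 6 * c 3 n - c 2 n := by
  have h := coeff_W 2 n
  have := Nat.factorial_ne_zero n
  rw [eq_div_iff (by positivity)] at h
  rw [← h, W2_eq]
  have e : (5 * u ^ 5 - 10 * u ^ 4 + 6 * u ^ 3 - u ^ 2 : ℝ⟦X⟧) =
    (5 : ℝ) • u ^ 5 - (10 : ℝ) • u ^ 4 + (6 : ℝ) • u ^ 3 - u ^ 2 := by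
    simp only [Algebra.smul_def, map_ofNat]
  rw [e]
  simp only [c, map_sub, map_add, coeff_smul, smul_eq_mul]
  ring

lemma S3_eq (n : ℕ) : S n (fun y => (y : ℝ) ^ 3) =
    90 * c 8 n - 278 * c 7 n + 317 * c 6 n - 161 * c 5 n + 34 * c 4 n - 2 * c 3 n := by
  have h := coeff_W 3 n
  have := Nat.factorial_ne_zero n
  rw [eq_div_iff (by positivity)] at h
  rw [← h, W3_eq]
  have e : (90 * u ^ 8 - 278 * u ^ 7 + 317 * u ^ 6 - 161 * u ^ 5 + 34 * u ^ 4 - 2 * u ^ 3 : ℝ⟦X⟧) =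
    (90 : ℝ) • u ^ 8 - (278 : ℝ) • u ^ 7 + (317 : ℝ) • u ^ 6 - (161 : ℝ) • u ^ 5 + (34 : ℝ) • u ^ 4 - (2 : ℝ) • u ^ 3 := by
    simp only [Algebra.smul_def, map_ofNat]
  rw [e]
  simp only [c, map_sub, map_add, coeff_smul, smul_eq_mul]
  ring
end TH

namespace TH
open MeasureTheory Filter Topology

lemma int_pow_exp (s : ℝ) (hs : 0 < s) (k : ℕ) :
    IntegrableOn (fun x : ℝ => x ^ k * Real.exp (-(s * x))) (Set.Ioi 0) ∧
    ∫ x in Set.Ioi (0:ℝ), x ^ k * Real.exp (-(s * x)) = (k.factorial : ℝ) / s ^ (k + 1) := by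
  constructor
  · have h := integrableOn_rpow_mul_exp_neg_mul_rpow (p := 1) (s := (k:ℝ)) (b := s)
      (by have : (0:ℝ) ≤ k := Nat.cast_nonneg k
          linarith) one_pos hs
    simpa [Real.rpow_natCast, neg_mul] using h
  · have h := Real.integral_rpow_mul_exp_neg_mul_Ioi (a := (k:ℝ) + 1) (r := s) (by positivity) hs
    rw [Real.Gamma_nat_eq_factorial] at h
    have e : ((k:ℝ) + 1) = ((k + 1 : ℕ) : ℝ) := by push_cast; ring
    have h1 : (k:ℝ) + 1 - 1 = (k : ℝ) := by ring
    rw [h1] at h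
    simp only [Real.rpow_natCast] at h
    rw [h, e, Real.rpow_natCast]
    rw [one_div, inv_pow]
    field_simp

noncomputable def g (n : ℕ) (x : ℝ) : ℝ := (x / √n + 1) ^ n * Real.exp (-(√n * x))

lemma int_g (n : ℕ) (hn : 0 < n) :
    ∫ x in Set.Ioi (0:ℝ), g n x = c 2 n / ((n:ℝ) ^ n * √n) := by
  have hn' : (0:ℝ) < n := by exact_mod_cast hn
  have hs : 0 < √(n:ℝ) := Real.sqrt_pos.mpr hn'
  have hss : √(n:ℝ) * √n = n := Real.mul_self_sqrt hn'.le
  have e : ∀ x, g n x = ∑ m ∈ Finset.range (n + 1),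
      ((n.choose m : ℝ) / √n ^ m) * (x ^ m * Real.exp (-(√n * x))) := by
    intro x
    rw [g, add_pow, Finset.sum_mul]
    refine Finset.sum_congr rfl fun m _ => ?_
    rw [one_pow, div_pow]; ring
  simp_rw [e]
  rw [integral_finsetSum]
  · simp_rw [integral_const_mul, (int_pow_exp _ hs _).2]
    rw [c_two, Finset.sum_div, ← Finset.sum_range_reflect]
    refine Finset.sum_congr rfl fun m hm => ?_
    have hm' : m ≤ n := by simpa [Nat.lt_succ_iff] using hm
    have h1 : n + 1 - 1 - m = n - m := by omega
    rw [h1]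
    have h2 : ((n.choose (n - m) : ℝ)) * ((n - m).factorial : ℝ) * (m.factorial : ℝ)
        = n.factorial := by
      have := Nat.choose_mul_factorial_mul_factorial (Nat.sub_le n m)
      rw [Nat.sub_sub_self hm'] at this
      exact_mod_cast this
    have h3 : (n:ℝ) ^ n = √n ^ (n - m) * √n ^ (n - m) * (n:ℝ) ^ m := by
      rw [← mul_pow, hss, ← pow_add]; congr 1; omega
    have h4 : (m.factorial : ℝ) ≠ 0 := by positivity
    rw [← h2, h3, pow_succ]
    have : (n:ℝ) ^ m ≠ 0 := by positivity
    field_simp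
  · intro m _
    exact ((int_pow_exp _ hs m).1).const_mul _

lemma log_upper (y : ℝ) (hy : 0 ≤ y) : Real.log (1 + y) - y ≤ - (y ^ 2 / (2 * (1 + y))) := by
  have h := Real.self_le_sinh_iff.mpr (Real.log_nonneg (by linarith : (1:ℝ) ≤ 1 + y))
  rw [Real.sinh_log (by linarith)] at h
  have : (1 + y - (1 + y)⁻¹) / 2 - y = - (y ^ 2 / (2 * (1 + y))) := by
    have : 1 + y ≠ 0 := by positivity
    field_simp
    ring
  linarith

lemma log_lower (y : ℝ) (hy : 0 ≤ y) : - (y ^ 2 / (y + 2)) ≤ Real.log (1 + y) - y := by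
  have h := Real.le_log_one_add_of_nonneg hy
  have : 2 * y / (y + 2) - y = - (y ^ 2 / (y + 2)) := by
    have : y + 2 ≠ 0 := by positivity
    field_simp
    ring
  linarith

lemma g_eq (n : ℕ) (hn : 0 < n) (x : ℝ) (hx : 0 < x) :
    g n x = Real.exp (n * (Real.log (1 + x / √n) - x / √n)) := by
  have hn' : (0:ℝ) < n := by exact_mod_cast hn
  have hs : 0 < √(n:ℝ) := Real.sqrt_pos.mpr hn'
  have hss : √(n:ℝ) * √n = n := Real.mul_self_sqrt hn'.le
  have h1 : (n:ℝ) * (Real.log (1 + x / √n) - x / √n)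
      = (n:ℝ) * Real.log (1 + x / √n) + -(√n * x) := by
    have : (n:ℝ) * (x / √n) = √n * x := by
      nth_rewrite 1 [← hss]; field_simp
    rw [mul_sub, this]; ring
  rw [h1, Real.exp_add, Real.exp_nat_mul, Real.exp_log (by positivity), g, add_comm 1]

lemma sq_div_sqrt (n : ℕ) (hn : 0 < n) (x : ℝ) : (n:ℝ) * (x / √n) ^ 2 = x ^ 2 := by
  have hn' : (0:ℝ) < n := by exact_mod_cast hn
  rw [div_pow, Real.sq_sqrt hn'.le]; field_simp

lemma g_upper (n : ℕ) (hn : 0 < n) (x : ℝ) (hx : 0 < x) :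
    g n x ≤ Real.exp (-(x ^ 2 / (2 * (1 + x / √n)))) := by
  rw [g_eq n hn x hx]
  apply Real.exp_le_exp.mpr
  have h := mul_le_mul_of_nonneg_left (log_upper (x / √n) (by positivity)) (Nat.cast_nonneg n (α := ℝ))
  rw [mul_neg, mul_div_assoc', sq_div_sqrt n hn] at h
  exact h

lemma g_lower (n : ℕ) (hn : 0 < n) (x : ℝ) (hx : 0 < x) :
    Real.exp (-(x ^ 2 / (x / √n + 2))) ≤ g n x := by
  rw [g_eq n hn x hx]
  apply Real.exp_le_exp.mpr
  have h := mul_le_mul_of_nonneg_left (log_lower (x / √n) (by positivity)) (Nat.cast_nonneg n (α := ℝ))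
  rw [mul_neg, mul_div_assoc', sq_div_sqrt n hn] at h
  exact h

lemma g_bound (n : ℕ) (hn : 0 < n) (x : ℝ) (hx : 0 < x) :
    g n x ≤ Real.exp (1 / 2) * Real.exp (-(1/2) * x) := by
  refine (g_upper n hn x hx).trans ?_
  rw [← Real.exp_add]
  apply Real.exp_le_exp.mpr
  have h1 : (1:ℝ) ≤ √n := by
    rw [Real.one_le_sqrt]; exact_mod_cast hn
  have h2 : x / √n ≤ x := div_le_self hx.le h1
  have h3 : x ^ 2 / (2 * (1 + x)) ≤ x ^ 2 / (2 * (1 + x / √n)) := by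
    gcongr
  have h4 : (x - 1) / 2 ≤ x ^ 2 / (2 * (1 + x)) := by
    rw [le_div_iff₀ (by positivity)]; nlinarith
  linarith

lemma sqrt_tendsto : Tendsto (fun n : ℕ => √(n:ℝ)) atTop atTop :=
  Real.tendsto_sqrt_atTop.comp tendsto_natCast_atTop_atTop

lemma g_tendsto (x : ℝ) (hx : 0 < x) :
    Tendsto (fun n : ℕ => g n x) atTop (𝓝 (Real.exp (-(1/2) * x ^ 2))) := by
  have hy : Tendsto (fun n : ℕ => x / √(n:ℝ)) atTop (𝓝 0) :=
    tendsto_const_nhds.div_atTop sqrt_tendsto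
  refine tendsto_of_tendsto_of_tendsto_of_le_of_le'
    (g := fun n : ℕ => Real.exp (-(x ^ 2 / (x / √n + 2))))
    (h := fun n : ℕ => Real.exp (-(x ^ 2 / (2 * (1 + x / √n))))) ?_ ?_ ?_ ?_
  · have e : -(1/2) * x ^ 2 = -(x ^ 2 / (0 + 2)) := by ring
    rw [e]
    exact (Real.continuous_exp.tendsto _).comp
      ((tendsto_const_nhds.div (hy.add_const 2) (by norm_num)).neg)
  · have e : -(1/2) * x ^ 2 = -(x ^ 2 / (2 * (1 + 0))) := by ring
    rw [e]
    exact (Real.continuous_exp.tendsto _).comp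
      ((tendsto_const_nhds.div ((hy.const_add 1).const_mul 2) (by norm_num)).neg)
  · filter_upwards [eventually_gt_atTop 0] with n hn using g_lower n hn x hx
  · filter_upwards [eventually_gt_atTop 0] with n hn using g_upper n hn x hx

lemma c_two_limit :
    Tendsto (fun n : ℕ => c 2 n / ((n:ℝ) ^ n * √n)) atTop (𝓝 (√(2 * Real.pi) / 2)) := by
  have h : Tendsto (fun n : ℕ => ∫ x in Set.Ioi (0:ℝ), g n x) atTop
      (𝓝 (∫ x in Set.Ioi (0:ℝ), Real.exp (-(1/2) * x ^ 2))) := by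
    refine tendsto_integral_filter_of_dominated_convergence
      (fun x => Real.exp (1 / 2) * Real.exp (-(1/2) * x)) ?_ ?_ ?_ ?_
    · refine Eventually.of_forall fun n => ?_
      apply Continuous.aestronglyMeasurable
      unfold g
      fun_prop
    · filter_upwards [eventually_gt_atTop 0] with n hn
      filter_upwards [ae_restrict_mem measurableSet_Ioi] with x hx
      have h0 : 0 ≤ g n x := by
        rw [g_eq n hn x hx]; exact (Real.exp_pos _).le
      rw [Real.norm_of_nonneg h0]
      exact g_bound n hn x hx
    · exact (exp_neg_integrableOn_Ioi 0 (by norm_num : (0:ℝ) < 1/2)).const_mul _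
    · filter_upwards [ae_restrict_mem measurableSet_Ioi] with x hx
      exact g_tendsto x hx
  rw [integral_gaussian_Ioi] at h
  have e : Real.pi / (1/2) = 2 * Real.pi := by ring
  rw [e] at h
  refine h.congr' ?_
  filter_upwards [eventually_gt_atTop 0] with n hn using int_g n hn

end TH

namespace TH
open Filter Topology

/-- normalised coefficients -/
noncomputable def ee (i n : ℕ) : ℝ := c i n / ((n:ℝ) ^ n * √n ^ (i - 1))

lemma ee_rec (i n : ℕ) (hn : 0 < n) :
    ee (i + 3) n = ee (i + 2) n * (√(n:ℝ))⁻¹ + ee (i + 1) n / (i + 1) := by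
  have hn' : (0:ℝ) < n := by exact_mod_cast hn
  have hs : 0 < √(n:ℝ) := Real.sqrt_pos.mpr hn'
  have hss : (n:ℝ) = √(n:ℝ) ^ 2 := (Real.sq_sqrt hn'.le).symm
  have hi : (i:ℝ) + 1 ≠ 0 := by positivity
  unfold ee
  rw [c_rec]
  have h1 : i + 3 - 1 = i + 2 := by omega
  have h2 : i + 2 - 1 = i + 1 := by omega
  have h3 : i + 1 - 1 = i := by omega
  rw [h1, h2, h3]
  have hP : (n:ℝ) ^ n ≠ 0 := by positivity
  generalize (n:ℝ) ^ n = P at *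
  rw [hss]
  simp only [Real.sqrt_sq hs.le]
  generalize √(n:ℝ) = s at *
  have hs' := hs.ne'
  rw [pow_succ s (i+1), pow_succ s i]
  field_simp

lemma inv_tendsto : Tendsto (fun n : ℕ => (√(n:ℝ))⁻¹) atTop (𝓝 0) :=
  tendsto_inv_atTop_zero.comp sqrt_tendsto

lemma ee_step (i : ℕ) (a b : ℝ) (h1 : Tendsto (ee (i + 1)) atTop (𝓝 a))
    (h2 : Tendsto (ee (i + 2)) atTop (𝓝 b)) :
    Tendsto (ee (i + 3)) atTop (𝓝 (a / (i + 1))) := by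
  have h := (h2.mul inv_tendsto).add (h1.div_const ((i:ℝ) + 1))
  rw [mul_zero, zero_add] at h
  refine h.congr' ?_
  filter_upwards [eventually_gt_atTop 0] with n hn
  exact (ee_rec i n hn).symm

lemma ee1 : Tendsto (ee 1) atTop (𝓝 1) := by
  refine tendsto_const_nhds.congr' ?_
  filter_upwards [eventually_gt_atTop 0] with n hn
  have hn' : (0:ℝ) < n := by exact_mod_cast hn
  simp only [ee, c_one]
  have hP : (n:ℝ) ^ n ≠ 0 := by positivity
  simp [hP]

lemma ee2 : Tendsto (ee 2) atTop (𝓝 (√(2 * Real.pi) / 2)) := by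
  have h := c_two_limit
  refine h.congr fun n => ?_
  simp [ee]

lemma ee3 : Tendsto (ee 3) atTop (𝓝 1) := by
  have h := ee_step 0 _ _ ee1 ee2
  convert h using 2; norm_num

lemma ee4 : Tendsto (ee 4) atTop (𝓝 (√(2 * Real.pi) / 4)) := by
  have h := ee_step 1 _ _ ee2 ee3
  convert h using 2; push_cast; ring

lemma ee5 : Tendsto (ee 5) atTop (𝓝 (1 / 3)) := by
  have h := ee_step 2 _ _ ee3 ee4
  convert h using 2; push_cast; ring

lemma ee6 : Tendsto (ee 6) atTop (𝓝 (√(2 * Real.pi) / 16)) := by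
  have h := ee_step 3 _ _ ee4 ee5
  convert h using 2; push_cast; ring

lemma ee7 : Tendsto (ee 7) atTop (𝓝 (1 / 15)) := by
  have h := ee_step 4 _ _ ee5 ee6
  convert h using 2; push_cast; ring

lemma ee8 : Tendsto (ee 8) atTop (𝓝 (√(2 * Real.pi) / 96)) := by
  have h := ee_step 5 _ _ ee6 ee7
  convert h using 2; push_cast; ring

/-- moments of the shifted total height -/
noncomputable def M (k n : ℕ) : ℝ := S n (fun y => (y:ℝ) ^ k) / tk n

lemma tk_eq (n : ℕ) (hn : 0 < n) : tk n = (n:ℝ) ^ n / √n ^ 2 := by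
  have hn' : (0:ℝ) < n := by exact_mod_cast hn
  rw [tk, if_neg hn.ne', Real.sq_sqrt hn'.le]
  obtain ⟨m, rfl⟩ := Nat.exists_eq_succ_of_ne_zero hn.ne'
  simp only [Nat.succ_eq_add_one, Nat.add_sub_cancel] at *
  rw [pow_succ]; field_simp

lemma M1_lim : Tendsto (fun n : ℕ => M 1 n / √(n:ℝ) ^ 3) atTop (𝓝 (√(2 * Real.pi) / 2)) := by
  have h := ee2.sub (ee1.mul inv_tendsto)
  rw [mul_zero, sub_zero] at h
  refine h.congr' ?_
  filter_upwards [eventually_gt_atTop 0] with n hn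
  have hn' : (0:ℝ) < n := by exact_mod_cast hn
  have hs : √(n:ℝ) ≠ 0 := (Real.sqrt_pos.mpr hn').ne'
  have hP : (n:ℝ) ^ n ≠ 0 := by positivity
  rw [M, S1_eq, tk_eq n hn]
  simp only [ee, Nat.reduceSub]
  generalize (n:ℝ) ^ n = P at *
  generalize √(n:ℝ) = s at *
  field_simp

lemma M2_lim : Tendsto (fun n : ℕ => M 2 n / √(n:ℝ) ^ 6) atTop (𝓝 (5 / 3)) := by
  have h := (((ee5.const_mul 5).sub ((ee4.const_mul 10).mul inv_tendsto)).add
    ((ee3.const_mul 6).mul (inv_tendsto.pow 2))).sub (ee2.mul (inv_tendsto.pow 3))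
  have e : (5:ℝ) * (1 / 3) - 10 * (√(2 * Real.pi) / 4) * 0 + 6 * 1 * 0 ^ 2
      - √(2 * Real.pi) / 2 * 0 ^ 3 = 5 / 3 := by ring
  rw [e] at h
  refine h.congr' ?_
  filter_upwards [eventually_gt_atTop 0] with n hn
  have hn' : (0:ℝ) < n := by exact_mod_cast hn
  have hs : √(n:ℝ) ≠ 0 := (Real.sqrt_pos.mpr hn').ne'
  have hP : (n:ℝ) ^ n ≠ 0 := by positivity
  rw [M, S2_eq, tk_eq n hn]
  simp only [ee, Nat.reduceSub]
  generalize (n:ℝ) ^ n = P at *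
  generalize √(n:ℝ) = s at *
  field_simp

lemma M3_lim : Tendsto (fun n : ℕ => M 3 n / √(n:ℝ) ^ 9) atTop
    (𝓝 (15 * √(2 * Real.pi) / 16)) := by
  have h := (((((ee8.const_mul 90).sub ((ee7.const_mul 278).mul inv_tendsto)).add
    ((ee6.const_mul 317).mul (inv_tendsto.pow 2))).sub
    ((ee5.const_mul 161).mul (inv_tendsto.pow 3))).add
    ((ee4.const_mul 34).mul (inv_tendsto.pow 4))).sub
    ((ee3.const_mul 2).mul (inv_tendsto.pow 5))
  have e : (90:ℝ) * (√(2 * Real.pi) / 96) - 278 * (1 / 15) * 0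
      + 317 * (√(2 * Real.pi) / 16) * 0 ^ 2 - 161 * (1 / 3) * 0 ^ 3
      + 34 * (√(2 * Real.pi) / 4) * 0 ^ 4 - 2 * 1 * 0 ^ 5 = 15 * √(2 * Real.pi) / 16 := by ring
  rw [e] at h
  refine h.congr' ?_
  filter_upwards [eventually_gt_atTop 0] with n hn
  have hn' : (0:ℝ) < n := by exact_mod_cast hn
  have hs : √(n:ℝ) ≠ 0 := (Real.sqrt_pos.mpr hn').ne'
  have hP : (n:ℝ) ^ n ≠ 0 := by positivity
  rw [M, S3_eq, tk_eq n hn]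
  simp only [ee, Nat.reduceSub]
  generalize (n:ℝ) ^ n = P at *
  generalize √(n:ℝ) = s at *
  field_simp

lemma card_tk (n : ℕ) : ((RootedLabeledTrees n).card : ℝ) = tk n := by
  rw [card_trees, ← card_eq]; simp

lemma tk_pos (n : ℕ) (hn : 0 < n) : 0 < tk n := by
  have hn' : (0:ℝ) < n := by exact_mod_cast hn
  have hs : 0 < √(n:ℝ) := Real.sqrt_pos.mpr hn'
  rw [tk_eq n hn]; positivity

lemma sumY (k n : ℕ) (hn : 0 < n) :
    ∑ p ∈ RootedLabeledTrees n, ((rlTotalHeight n p : ℝ) + n) ^ k = tk n * M k n := by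
  have h := sum_trees n (fun y => (y:ℝ) ^ k)
  push_cast at h
  rw [h, M, mul_div_cancel₀ _ (tk_pos n hn).ne']

lemma mu_eq (n : ℕ) (hn : 0 < n) : rlMu n = M 1 n - n := by
  have h := sumY 1 n hn
  simp only [pow_one, Finset.sum_add_distrib, Finset.sum_const, nsmul_eq_mul, card_tk] at h
  have ht := (tk_pos n hn).ne'
  rw [rlMu, card_tk]
  field_simp
  linarith

lemma m2_eq (n : ℕ) (hn : 0 < n) : rlCentralMoment 2 n = M 2 n - M 1 n ^ 2 := by
  have h1 := sumY 1 n hn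
  have h2 := sumY 2 n hn
  have ht := (tk_pos n hn).ne'
  rw [rlCentralMoment, card_tk, mu_eq n hn]
  have e : ∑ p ∈ RootedLabeledTrees n, ((rlTotalHeight n p : ℝ) - (M 1 n - n)) ^ 2
      = tk n * M 2 n - 2 * M 1 n * (tk n * M 1 n) + tk n * M 1 n ^ 2 := by
    rw [← h2, ← h1, ← card_tk, ← nsmul_eq_mul, ← Finset.sum_const, Finset.mul_sum,
      ← Finset.sum_sub_distrib, ← Finset.sum_add_distrib]
    refine Finset.sum_congr rfl fun p _ => ?_
    ring
  rw [e]; field_simp; ring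

lemma m3_eq (n : ℕ) (hn : 0 < n) :
    rlCentralMoment 3 n = M 3 n - 3 * M 1 n * M 2 n + 2 * M 1 n ^ 3 := by
  have h1 := sumY 1 n hn
  have h2 := sumY 2 n hn
  have h3 := sumY 3 n hn
  have ht := (tk_pos n hn).ne'
  rw [rlCentralMoment, card_tk, mu_eq n hn]
  have e : ∑ p ∈ RootedLabeledTrees n, ((rlTotalHeight n p : ℝ) - (M 1 n - n)) ^ 3
      = tk n * M 3 n - 3 * M 1 n * (tk n * M 2 n) + 3 * M 1 n ^ 2 * (tk n * M 1 n)
        - tk n * M 1 n ^ 3 := by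
    rw [← h3, ← h2, ← h1, ← card_tk, ← nsmul_eq_mul, ← Finset.sum_const, Finset.mul_sum,
      Finset.mul_sum, ← Finset.sum_sub_distrib, ← Finset.sum_add_distrib,
      ← Finset.sum_sub_distrib]
    refine Finset.sum_congr rfl fun p _ => ?_
    ring
  rw [e]; field_simp; ring

lemma m2_lim : Tendsto (fun n : ℕ => rlCentralMoment 2 n / √(n:ℝ) ^ 6) atTop
    (𝓝 ((10 - 3 * Real.pi) / 6)) := by
  have h := M2_lim.sub (M1_lim.pow 2)
  have e : (5:ℝ) / 3 - (√(2 * Real.pi) / 2) ^ 2 = (10 - 3 * Real.pi) / 6 := by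
    rw [div_pow, Real.sq_sqrt (by positivity)]; ring
  rw [e] at h
  refine h.congr' ?_
  filter_upwards [eventually_gt_atTop 0] with n hn
  rw [m2_eq n hn]; ring

lemma m3_lim : Tendsto (fun n : ℕ => rlCentralMoment 3 n / √(n:ℝ) ^ 9) atTop
    (𝓝 (√(2 * Real.pi) * (8 * Real.pi - 25) / 16)) := by
  have h := (M3_lim.sub ((M1_lim.const_mul 3).mul M2_lim)).add ((M1_lim.pow 3).const_mul 2)
  have e : 15 * √(2 * Real.pi) / 16 - 3 * (√(2 * Real.pi) / 2) * (5 / 3)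
      + 2 * (√(2 * Real.pi) / 2) ^ 3 = √(2 * Real.pi) * (8 * Real.pi - 25) / 16 := by
    have h3 : √(2 * Real.pi) ^ 3 = √(2 * Real.pi) * (2 * Real.pi) := by
      rw [pow_succ, Real.sq_sqrt (by positivity)]; ring
    rw [div_pow, h3]; ring
  rw [e] at h
  refine h.congr' ?_
  filter_upwards [eventually_gt_atTop 0] with n hn
  rw [m3_eq n hn]; ring

lemma rpow_three_half (a : ℝ) (ha : 0 ≤ a) : a ^ (((3:ℕ) : ℝ) / 2) = √a ^ 3 := by
  rw [Real.sqrt_eq_rpow, ← Real.rpow_natCast, ← Real.rpow_mul ha]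
  congr 1; push_cast; ring

lemma m2_nonneg (n : ℕ) : 0 ≤ rlCentralMoment 2 n := by
  rw [rlCentralMoment]; positivity

lemma alpha_eq (n : ℕ) (hn : 0 < n) : rlAlpha 3 n =
    (rlCentralMoment 3 n / √(n:ℝ) ^ 9) / √(rlCentralMoment 2 n / √(n:ℝ) ^ 6) ^ 3 := by
  have hn' : (0:ℝ) < n := by exact_mod_cast hn
  have hs : 0 < √(n:ℝ) := Real.sqrt_pos.mpr hn'
  rw [rlAlpha, rpow_three_half _ (m2_nonneg n), Real.sqrt_div (m2_nonneg n)]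
  have : √(√(n:ℝ) ^ 6) = √(n:ℝ) ^ 3 := by
    rw [show √(n:ℝ) ^ 6 = (√(n:ℝ) ^ 3) ^ 2 by ring, Real.sqrt_sq (by positivity)]
  rw [this, div_pow, div_div_div_eq, ← pow_mul]
  norm_num
  field_simp

lemma ten_pos : 0 < 10 - 3 * Real.pi := by
  have := Real.pi_lt_d2
  norm_num at this
  linarith

lemma const_eq : √(2 * Real.pi) * (8 * Real.pi - 25) / 16 / √((10 - 3 * Real.pi) / 6) ^ 3 =
    (6 * Real.pi - 75 / 4) * √3 * √(Real.pi / (10 - 3 * Real.pi)) / (10 - 3 * Real.pi) := by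
  have hD := ten_pos
  set D := 10 - 3 * Real.pi with hDdef
  have hpi := Real.pi_pos
  have h6 : √(6:ℝ) = √2 * √3 := by
    rw [← Real.sqrt_mul (by norm_num)]; norm_num
  rw [Real.sqrt_div hD.le, Real.sqrt_div hpi.le, Real.sqrt_mul (by norm_num), h6]
  have a2 : √(2:ℝ) ^ 2 = 2 := Real.sq_sqrt (by norm_num)
  have a3 : √(3:ℝ) ^ 2 = 3 := Real.sq_sqrt (by norm_num)
  have aD : √D ^ 2 = D := Real.sq_sqrt hD.le
  have p2 : 0 < √(2:ℝ) := by positivity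
  have p3 : 0 < √(3:ℝ) := by positivity
  have pD : 0 < √D := Real.sqrt_pos.mpr hD
  have e : √(2:ℝ) * √Real.pi * (8 * Real.pi - 25) / 16 / (√D / (√2 * √3)) ^ 3
      = (√2 ^ 2) ^ 2 * (√3 ^ 2) * √3 * √Real.pi * (8 * Real.pi - 25) / (16 * (√D ^ 2 * √D)) := by
    field_simp
  rw [e, a2, a3, aD]
  field_simp
  ring

theorem main : Tendsto (fun n : ℕ => rlAlpha 3 n) atTop
    (𝓝 ((6 * Real.pi - 75 / 4) * √3 * √(Real.pi / (10 - 3 * Real.pi)) / (10 - 3 * Real.pi))) := by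
  have hD := ten_pos
  have hq : √((10 - 3 * Real.pi) / 6) ^ 3 ≠ 0 := by
    have : 0 < √((10 - 3 * Real.pi) / 6) := Real.sqrt_pos.mpr (by positivity)
    positivity
  have h := m3_lim.div (m2_lim.sqrt.pow 3) hq
  rw [const_eq] at h
  refine h.congr' ?_
  filter_upwards [eventually_gt_atTop 0] with n hn
  exact (alpha_eq n hn).symm

end TH

open Filter Real

/-- The `3`-th scaled moment of the total height on rooted labeled trees on `n`
vertices converges, as `n → ∞`, to the stated constant. -/
theorem totalheight_stmt14 :
    Tendsto (fun n : ℕ => rlAlpha 3 n) atTop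
      (nhds ((6 * π - 75 / 4) * Real.sqrt 3 * Real.sqrt (π / (10 - 3 * π)) / (10 - 3 * π))) := by
  exact TH.main
end

section
/- For n ≥ 1, let X_n be the random variable 'total height' (sum over all vertices of the graph distance to the root) on the set of rooted labeled trees on n vertices, equipped with the uniform distribution. Let μ(n) = E[X_n], m_i(n) = E[(X_n − μ(n))^i], and α_i(n) = m_i(n)/m_2(n)^{i/2}. Then the limit of the kurtosis exists and lim_{n→∞} α_4(n) = (−189π² + 315π + 884) / (7·(10 − 3π)²) ≈ 3.560394897132889…. -/
section Comb
open SimpleGraph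

/-- A map which sends edges to edges or collapses them shortens walks. -/
theorem th_walk_retract {V W : Type*} {G : SimpleGraph V} {H : SimpleGraph W} (f : V → W)
    (hf : ∀ x y, G.Adj x y → f x = f y ∨ H.Adj (f x) (f y)) {x y : V} (p : G.Walk x y) :
    ∃ q : H.Walk (f x) (f y), q.length ≤ p.length := by
  induction p with
  | nil => exact ⟨Walk.nil, by simp⟩
  | cons h p ih =>
    obtain ⟨q, hq⟩ := ih
    rcases hf _ _ h with h' | h'
    · rw [h']; exact ⟨q, by simp; omega⟩
    · exact ⟨Walk.cons h' q, by simpa using hq⟩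

theorem th_reach_retract {V W : Type*} {G : SimpleGraph V} {H : SimpleGraph W} (f : V → W)
    (hf : ∀ x y, G.Adj x y → f x = f y ∨ H.Adj (f x) (f y)) {x y : V} (p : G.Reachable x y) :
    H.Reachable (f x) (f y) := by
  obtain ⟨p⟩ := p
  obtain ⟨q, _⟩ := th_walk_retract f hf p
  exact ⟨q⟩

theorem th_dist_retract {V W : Type*} {G : SimpleGraph V} {H : SimpleGraph W} (f : V → W)
    (hf : ∀ x y, G.Adj x y → f x = f y ∨ H.Adj (f x) (f y)) {x y : V} (hr : G.Reachable x y) :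
    H.dist (f x) (f y) ≤ G.dist x y := by
  obtain ⟨p, hp⟩ := hr.exists_walk_length_eq_dist
  obtain ⟨q, hq⟩ := th_walk_retract f hf p
  exact (dist_le q).trans (hp ▸ hq)

/-- `u` in `B`, `r` outside, is the unique edge of `G` across. -/
def THCross {V : Type*} (G : SimpleGraph V) (B : V → Prop) (u r : V) : Prop :=
  ∀ x y, B x → ¬ B y → (G.Adj x y ↔ x = u ∧ y = r)

open Classical in
noncomputable def thRet {V : Type*} (B : V → Prop) (u : {x // B x}) (x : V) : {x // B x} :=
  if h : B x then ⟨x, h⟩ else u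

theorem thRet_pos {V : Type*} (B : V → Prop) (u : {x // B x}) (x : V) (h : B x) :
    thRet B u x = ⟨x, h⟩ := by simp [thRet, h]
theorem thRet_neg {V : Type*} (B : V → Prop) (u : {x // B x}) (x : V) (h : ¬ B x) :
    thRet B u x = u := by simp [thRet, h]

theorem THCross.symm {V : Type*} {G : SimpleGraph V} {B : V → Prop} {u r : V}
    (h : THCross G B u r) : THCross G (fun x => ¬ B x) r u := by
  intro x y hx hy
  simp only [not_not] at hy
  rw [G.adj_comm, h y x hy hx, and_comm]

theorem THCross.ret {V : Type*} {G : SimpleGraph V} {B : V → Prop} {u r : V}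
    (h : THCross G B u r) (hu : B u) (x y : V) (hxy : G.Adj x y) :
    thRet B ⟨u, hu⟩ x = thRet B ⟨u, hu⟩ y ∨
      (G.comap (Subtype.val : {x // B x} → V)).Adj (thRet B ⟨u, hu⟩ x) (thRet B ⟨u, hu⟩ y) := by
  by_cases hx : B x <;> by_cases hy : B y
  · right; rw [thRet_pos _ _ _ hx, thRet_pos _ _ _ hy]; simpa using hxy
  · left; rw [thRet_pos _ _ _ hx, thRet_neg _ _ _ hy]; exact Subtype.ext ((h x y hx hy).1 hxy).1
  · left; rw [thRet_neg _ _ _ hx, thRet_pos _ _ _ hy]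
    exact Subtype.ext ((h y x hy hx).1 hxy.symm).1.symm
  · left; rw [thRet_neg _ _ _ hx, thRet_neg _ _ _ hy]

theorem THCross.connected_left {V : Type*} {G : SimpleGraph V} {B : V → Prop} {u r : V}
    (h : THCross G B u r) (hu : B u) (hG : G.Connected) :
    (G.comap (Subtype.val : {x // B x} → V)).Connected := by
  have : Nonempty {x // B x} := ⟨⟨u, hu⟩⟩
  refine ⟨fun x y => ?_⟩
  have := th_reach_retract _ (h.ret hu) (hG x.1 y.1)
  rwa [thRet_pos _ _ _ x.2, thRet_pos _ _ _ y.2] at this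

theorem THCross.dist_left {V : Type*} {G : SimpleGraph V} {B : V → Prop} {u r : V}
    (h : THCross G B u r) (hu : B u) (hG : G.Connected) (x y : {x // B x}) :
    G.dist x.1 y.1 = (G.comap (Subtype.val : {x // B x} → V)).dist x y := by
  apply le_antisymm
  · exact th_dist_retract (H := G) (Subtype.val : {x // B x} → V) (fun _ _ h => Or.inr h)
      (h.connected_left hu hG x y)
  · have := th_dist_retract _ (h.ret hu) (hG x.1 y.1)
    rwa [thRet_pos _ _ _ x.2, thRet_pos _ _ _ y.2] at this

theorem THCross.walk_cross {V : Type*} {G : SimpleGraph V} {B : V → Prop} {u r : V}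
    (h : THCross G B u r) {x y : V} (p : G.Walk x y) (hx : B x) (hy : ¬ B y) :
    ∃ q : G.Walk x u, q.length + 1 ≤ p.length := by
  induction p with
  | nil => exact absurd hx hy
  | @cons a b c hab p ih =>
    by_cases hb : B b
    · obtain ⟨q, hq⟩ := ih hb hy
      exact ⟨Walk.cons hab q, by simpa using hq⟩
    · obtain ⟨rfl, rfl⟩ := (h _ _ hx hb).1 hab
      exact ⟨Walk.nil, by simp⟩

theorem THCross.dist_cross {V : Type*} {G : SimpleGraph V} {B : V → Prop} {u r : V}
    (h : THCross G B u r) (hu : B u) (hr : ¬ B r) (hG : G.Connected) (x : {x // B x}) :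
    G.dist x.1 r = (G.comap (Subtype.val : {x // B x} → V)).dist x ⟨u, hu⟩ + 1 := by
  rw [← h.dist_left hu hG]
  apply le_antisymm
  · have := hG.dist_triangle (u := x.1) (v := u) (w := r)
    have h1 : G.dist u r = 1 := dist_eq_one_iff_adj.2 ((h u r hu hr).2 ⟨rfl, rfl⟩)
    simp only
    omega
  · obtain ⟨p, hp⟩ := (hG x.1 r).exists_walk_length_eq_dist
    obtain ⟨q, hq⟩ := h.walk_cross p x.2 hr
    have := dist_le q
    simp only
    omega

theorem THCross.not_reach {V : Type*} {G : SimpleGraph V} {B : V → Prop} {u r : V}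
    (h : THCross G B u r) {H : SimpleGraph V} (hH : H ≤ G) (hur : ¬ H.Adj u r)
    {x y : V} (hx : B x) (p : H.Reachable x y) : B y := by
  obtain ⟨p⟩ := p
  induction p with
  | nil => exact hx
  | @cons a b c hab p ih =>
    apply ih
    by_contra hb
    obtain ⟨rfl, rfl⟩ := (h _ _ hx hb).1 (hH hab)
    exact hur hab

theorem THCross.isBridge_left {V : Type*} {G : SimpleGraph V} {B : V → Prop} {u r : V}
    (h : THCross G B u r) (hu : B u)
    (h1 : (G.comap (Subtype.val : {x // B x} → V)).IsAcyclic) {x y : V} (hx : B x) (hy : B y)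
    (hxy : G.Adj x y) : ¬ (G.deleteEdges {s(x, y)}).Reachable x y := by
  intro hre
  have hb := (isAcyclic_iff_forall_adj_isBridge.1 h1) (v := ⟨x, hx⟩) (w := ⟨y, hy⟩) hxy
  rw [isBridge_iff] at hb
  apply hb
  have := th_reach_retract (H := (G.comap (Subtype.val : {x // B x} → V)).deleteEdges {s(⟨x, hx⟩, ⟨y, hy⟩)})
    (thRet B ⟨u, hu⟩) (fun a b hab => ?_) hre
  · rwa [thRet_pos _ _ _ hx, thRet_pos _ _ _ hy] at this
  · rw [deleteEdges_adj] at hab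
    by_cases ha : B a <;> by_cases hb : B b
    · right
      rw [thRet_pos _ _ _ ha, thRet_pos _ _ _ hb, deleteEdges_adj]
      refine ⟨hab.1, fun h' => hab.2 ?_⟩
      simpa [Subtype.ext_iff] using h'
    · left; rw [thRet_pos _ _ _ ha, thRet_neg _ _ _ hb]
      exact Subtype.ext ((h a b ha hb).1 hab.1).1
    · left; rw [thRet_neg _ _ _ ha, thRet_pos _ _ _ hb]
      exact Subtype.ext ((h b a hb ha).1 hab.1.symm).1.symm
    · left; rw [thRet_neg _ _ _ ha, thRet_neg _ _ _ hb]

theorem THCross.isTree_iff {V : Type*} {G : SimpleGraph V} {B : V → Prop} {u r : V}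
    (h : THCross G B u r) (hu : B u) (hr : ¬ B r) :
    G.IsTree ↔ (G.comap (Subtype.val : {x // B x} → V)).IsTree ∧
      (G.comap (Subtype.val : {x // ¬ B x} → V)).IsTree := by
  constructor
  · intro hG
    refine ⟨⟨h.connected_left hu hG.1, ?_⟩, ⟨h.symm.connected_left hr hG.1, ?_⟩⟩
    · exact hG.2.of_comap (Function.Embedding.subtype _)
    · exact hG.2.of_comap (Function.Embedding.subtype _)
  · rintro ⟨h1, h2⟩
    have hadj : G.Adj u r := (h u r hu hr).2 ⟨rfl, rfl⟩
    constructor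
    · have key : ∀ x, G.Reachable x u := by
        intro x
        by_cases hx : B x
        · exact th_reach_retract (H := G) Subtype.val (fun _ _ h => Or.inr h)
            (h1.1 ⟨x, hx⟩ ⟨u, hu⟩)
        · exact (th_reach_retract (H := G) Subtype.val (fun _ _ h => Or.inr h)
            (h2.1 ⟨x, hx⟩ ⟨r, hr⟩)).trans hadj.symm.reachable
      have : Nonempty V := ⟨u⟩
      exact ⟨fun x y => (key x).trans (key y).symm⟩
    · rw [isAcyclic_iff_forall_adj_isBridge]
      intro x y hxy
      rw [isBridge_iff]
      by_cases hx : B x <;> by_cases hy : B y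
      · exact h.isBridge_left hu h1.2 hx hy hxy
      · obtain ⟨rfl, rfl⟩ := (h x y hx hy).1 hxy
        intro hre
        exact hr (h.not_reach (deleteEdges_le _) (by simp) hx hre)
      · obtain ⟨rfl, rfl⟩ := (h y x hy hx).1 hxy.symm
        intro hre
        exact hr (h.not_reach (deleteEdges_le _) (by simp) hy hre.symm)
      · exact h.symm.isBridge_left hr h2.2 hx hy hxy

open Classical in
theorem THCross.height {V : Type*} [Fintype V] {G : SimpleGraph V} {B : V → Prop} {u r : V}
    (h : THCross G B u r) (hu : B u) (hr : ¬ B r) (hG : G.Connected) :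
    ∑ v, G.dist v r = (∑ v, (G.comap (Subtype.val : {x // B x} → V)).dist v ⟨u, hu⟩)
      + (∑ v, (G.comap (Subtype.val : {x // ¬ B x} → V)).dist v ⟨r, hr⟩)
      + Fintype.card {x // B x} := by
  rw [← Fintype.sum_subtype_add_sum_subtype B]
  have h1 : ∀ i : {x // B x}, G.dist i.1 r = _ := h.dist_cross hu hr hG
  have h2 : ∀ i : {x // ¬ B x}, G.dist i.1 r = _ := fun i => h.symm.dist_left hr hG i ⟨r, hr⟩
  simp_rw [h1, h2, Finset.sum_add_distrib]
  simp
  ring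

/-- Existence and uniqueness of the branch containing `v`. -/
theorem th_existsUnique_branch {V : Type*} [Fintype V] {G : SimpleGraph V} (hG : G.IsTree)
    {r v : V} (hv : v ≠ r) :
    ∃! p : Finset V × V, v ∈ p.1 ∧ p.2 ∈ p.1 ∧ r ∉ p.1 ∧ THCross G (· ∈ p.1) p.2 r := by
  classical
  let H : SimpleGraph V := 
    { Adj := fun x y => G.Adj x y ∧ x ≠ r ∧ y ≠ r
      symm := ⟨fun x y h => ⟨h.1.symm, h.2.2, h.2.1⟩⟩
      loopless := ⟨fun x h => G.loopless.irrefl x h.1⟩ }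
  have hH : H ≤ G := fun x y h => h.1
  have hHr : ∀ x, H.Reachable v x → x ≠ r := by
    rintro x ⟨p⟩
    induction p with
    | nil => exact hv
    | cons h p ih => exact ih h.2.2
  have hex : ∀ x y, G.Walk x y → y = r → H.Reachable v x →
      ∃ u, H.Reachable v u ∧ G.Adj u r := by
    intro x y p
    induction p with
    | nil => intro h hx; exact absurd h (hHr _ hx)
    | @cons a b c hab p ih =>
      intro h hx
      by_cases hb : b = r
      · exact ⟨a, hx, hb ▸ hab⟩
      · exact ih h (hx.trans (Adj.reachable ⟨hab, hHr _ hx, hb⟩))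
  obtain ⟨pw⟩ := hG.1 v r
  obtain ⟨u, hu, hur⟩ := hex v r pw rfl (Reachable.refl _)
  have huni : ∀ u', H.Reachable v u' → G.Adj u' r → u' = u := by
    intro u' hu' hur'
    by_contra hne
    have := (isAcyclic_iff_forall_adj_isBridge.1 hG.2) hur
    rw [isBridge_iff] at this
    apply this
    have h1 : (G.deleteEdges {s(u, r)}).Reachable u u' := by
      refine (hu.symm.trans hu').mono ?_
      intro x y hxy
      rw [deleteEdges_adj]
      refine ⟨hxy.1, ?_⟩
      simp only [Set.mem_singleton_iff, Sym2.eq_iff]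
      rintro (⟨_, h⟩ | ⟨h, _⟩)
      · exact hxy.2.2 h
      · exact hxy.2.1 h
    refine h1.trans (Adj.reachable ?_)
    rw [deleteEdges_adj]
    refine ⟨hur', ?_⟩
    simp only [Set.mem_singleton_iff, Sym2.eq_iff]
    rintro (⟨h, _⟩ | ⟨h, _⟩)
    · exact hne h
    · exact hHr _ hu' h
  refine ⟨(Finset.univ.filter (fun x => H.Reachable v x), u), ⟨?_, ?_, ?_, ?_⟩, ?_⟩
  · simp
  · simpa using hu
  · simpa using fun h => hHr _ h rfl
  · intro x y hx hy
    simp only [Finset.mem_filter, Finset.mem_univ, true_and] at hx hy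
    constructor
    · intro hxy
      have hyr : y = r := by
        by_contra hyr
        exact hy (hx.trans (Adj.reachable ⟨hxy, hHr _ hx, hyr⟩))
      subst hyr
      exact ⟨huni x hx hxy, rfl⟩
    · rintro ⟨rfl, rfl⟩; exact hur
  · rintro ⟨B, u'⟩ ⟨hvB, huB, hrB, hc⟩
    simp only at hvB huB hrB hc
    have hB : B = Finset.univ.filter (fun x => H.Reachable v x) := by
      ext x
      simp only [Finset.mem_filter, Finset.mem_univ, true_and]
      constructor
      · intro hx
        refine th_reach_retract (H := H) Subtype.val (fun a b hab => Or.inr ⟨hab, ?_, ?_⟩)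
          (hc.connected_left huB hG.1 ⟨v, hvB⟩ ⟨x, hx⟩)
        · rintro h; exact hrB (h ▸ a.2)
        · rintro h; exact hrB (h ▸ b.2)
      · intro hx
        exact hc.not_reach hH (fun h => h.2.2 rfl) hvB hx
    subst hB
    have := huni u' (by simpa using huB) ((hc _ _ huB hrB).2 ⟨rfl, rfl⟩)
    rw [this]
end Comb

section Comb2
open SimpleGraph

open Classical in
/-- Sum of `φ (total height)` over rooted trees on `V`. -/
noncomputable def thSum (V : Type*) [Fintype V] (φ : ℕ → ℝ) : ℝ :=
  ∑ p : SimpleGraph V × V, if p.1.IsTree then φ (∑ v, p.1.dist v p.2) else 0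

theorem thSum_congr {V W : Type*} [Fintype V] [Fintype W] (e : V ≃ W) (φ : ℕ → ℝ) :
    thSum V φ = thSum W φ := by
  classical
  unfold thSum
  refine Fintype.sum_equiv (e.simpleGraph.prodCongr e) _ _ ?_
  rintro ⟨G, r⟩
  have iso : G ≃g (e.simpleGraph G) := 
    { e with map_rel_iff' := by intro a b; simp [Equiv.simpleGraph] }
  have hiso : ∀ G : SimpleGraph V, G.IsTree ↔ (e.simpleGraph G).IsTree := fun G =>
    Iso.isTree_iff (G := G) (G' := e.simpleGraph G)
      { e with map_rel_iff' := by intro a b; simp [Equiv.simpleGraph] }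
  simp only [Equiv.prodCongr_apply, Prod.map]
  by_cases hG : G.IsTree
  · rw [if_pos hG, if_pos ((hiso G).1 hG)]
    congr 1
    refine Fintype.sum_equiv e _ _ ?_
    intro v
    apply le_antisymm
    · have := th_dist_retract (G := e.simpleGraph G) (H := G) e.symm (x := e v) (y := e r)
        (fun x y h => Or.inr (by simpa [Equiv.simpleGraph] using h)) (((hiso G).1 hG).1 _ _)
      simpa using this
    · exact th_dist_retract (G := G) (H := e.simpleGraph G) e
        (fun x y h => Or.inr (by simpa [Equiv.simpleGraph] using h)) (hG.1 _ _)
  · rw [if_neg hG, if_neg (fun h => hG ((hiso G).2 h))]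

/-- Gluing two graphs along an edge. -/
def thGlue {V : Type*} (B : V → Prop) (G1 : SimpleGraph {x // B x}) (G2 : SimpleGraph {x // ¬ B x})
    (u r : V) : SimpleGraph V where
  Adj x y := (∃ (hx : B x) (hy : B y), G1.Adj ⟨x, hx⟩ ⟨y, hy⟩) ∨
    (∃ (hx : ¬ B x) (hy : ¬ B y), G2.Adj ⟨x, hx⟩ ⟨y, hy⟩) ∨
    (B x ∧ ¬ B y ∧ x = u ∧ y = r) ∨ (B y ∧ ¬ B x ∧ y = u ∧ x = r)
  symm := ⟨by
    rintro x y (⟨hx, hy, h⟩ | ⟨hx, hy, h⟩ | h | h)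
    · exact Or.inl ⟨hy, hx, h.symm⟩
    · exact Or.inr (Or.inl ⟨hy, hx, h.symm⟩)
    · exact Or.inr (Or.inr (Or.inr h))
    · exact Or.inr (Or.inr (Or.inl h))⟩
  loopless := ⟨by
    rintro x (⟨hx, hy, h⟩ | ⟨hx, hy, h⟩ | h | h)
    · exact G1.loopless.irrefl _ h
    · exact G2.loopless.irrefl _ h
    · exact h.2.1 h.1
    · exact h.2.1 h.1⟩

theorem thGlue_cross {V : Type*} (B : V → Prop) (G1 : SimpleGraph {x // B x})
    (G2 : SimpleGraph {x // ¬ B x}) (u r : V) : THCross (thGlue B G1 G2 u r) B u r := by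
  intro x y hx hy
  simp [thGlue, hx, hy]

theorem thGlue_left {V : Type*} (B : V → Prop) (G1 : SimpleGraph {x // B x})
    (G2 : SimpleGraph {x // ¬ B x}) (u r : V) :
    (thGlue B G1 G2 u r).comap (Subtype.val : {x // B x} → V) = G1 := by
  ext x y
  simp [thGlue, x.2, y.2]

theorem thGlue_right {V : Type*} (B : V → Prop) (G1 : SimpleGraph {x // B x})
    (G2 : SimpleGraph {x // ¬ B x}) (u r : V) :
    (thGlue B G1 G2 u r).comap (Subtype.val : {x // ¬ B x} → V) = G2 := by
  ext x y
  simp [thGlue, x.2, y.2]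

theorem thGlue_eq {V : Type*} (B : V → Prop) (G : SimpleGraph V) (u r : V) (h : THCross G B u r) :
    thGlue B (G.comap Subtype.val) (G.comap Subtype.val) u r = G := by
  ext x y
  by_cases hx : B x <;> by_cases hy : B y
  · simp [thGlue, hx, hy]
  · simp [thGlue, hx, hy, h x y hx hy]
  · rw [G.adj_comm]; simp [thGlue, hx, hy, h y x hy hx]
  · simp [thGlue, hx, hy]

open Classical in
theorem thSum_cross {V : Type*} [Fintype V] (B : V → Prop)
    [Fintype {x // B x}] [Fintype {x // ¬ B x}] (u : {x // B x}) (r : {x // ¬ B x})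
    (φ : ℕ → ℝ) :
    (∑ G : SimpleGraph V, if G.IsTree ∧ THCross G B u r then φ (∑ v, G.dist v r) else 0) =
    ∑ G1 : SimpleGraph {x // B x}, ∑ G2 : SimpleGraph {x // ¬ B x},
      if G1.IsTree ∧ G2.IsTree then
        φ (∑ v, G1.dist v u + ∑ v, G2.dist v r + Fintype.card {x // B x}) else 0 := by
  rw [← Fintype.sum_prod_type', ← Finset.sum_filter, ← Finset.sum_filter]
  refine Finset.sum_nbij' (fun G => (G.comap Subtype.val, G.comap Subtype.val))
    (fun p => thGlue B p.1 p.2 u r) ?_ ?_ ?_ ?_ ?_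
  · intro G hG
    simp only [Finset.mem_filter, Finset.mem_univ, true_and] at hG ⊢
    exact (hG.2.isTree_iff u.2 r.2).1 hG.1
  · rintro ⟨G1, G2⟩ hG
    simp only [Finset.mem_filter, Finset.mem_univ, true_and] at hG ⊢
    have hc := thGlue_cross B G1 G2 u r
    refine ⟨(hc.isTree_iff u.2 r.2).2 ?_, hc⟩
    rw [thGlue_left, thGlue_right]; exact hG
  · intro G hG
    simp only [Finset.mem_filter, Finset.mem_univ, true_and] at hG ⊢
    exact thGlue_eq B G u r hG.2
  · rintro ⟨G1, G2⟩ hG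
    simp only
    rw [thGlue_left, thGlue_right]
  · intro G hG
    simp only [Finset.mem_filter, Finset.mem_univ, true_and] at hG ⊢
    rw [hG.2.height u.2 r.2 hG.1.1]
    congr!

open Classical in
theorem thSum_eq {V : Type*} [Fintype V] [inst : Fintype (SimpleGraph V)] (φ : ℕ → ℝ) :
    thSum V φ = ∑ r : V, ∑ G : SimpleGraph V, if G.IsTree then φ (∑ v, G.dist v r) else 0 := by
  have h : inst = instFintypeSimpleGraphOfDecidableEq := Subsingleton.elim _ _
  subst h
  unfold thSum
  rw [Fintype.sum_prod_type_right]

open Classical in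
theorem thSum_branch {V : Type*} [Fintype V] (B : V → Prop)
    [Fintype {x // B x}] [Fintype {x // ¬ B x}] (φ : ℕ → ℝ) :
    (∑ u : {x // B x}, ∑ r : {x // ¬ B x}, ∑ G : SimpleGraph V,
      if G.IsTree ∧ THCross G B u r then φ (∑ v, G.dist v r) else 0) =
    thSum {x // B x} (fun a => thSum {x // ¬ B x}
      (fun b => φ (a + b + Fintype.card {x // B x}))) := by
  rw [thSum_eq]
  refine Finset.sum_congr rfl fun u _ => ?_
  rw [Finset.sum_congr rfl (fun r _ => thSum_cross B u r φ)]
  refine Finset.sum_comm.trans ?_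
  refine Finset.sum_congr rfl fun G1 _ => ?_
  by_cases h2 : G1.IsTree
  · rw [if_pos h2, thSum_eq]
    simp only [h2, true_and]
  · simp [h2]

open Classical in
theorem thSum_rec {V : Type*} [Fintype V] (φ : ℕ → ℝ) :
    ((Fintype.card V : ℝ) - 1) * thSum V φ = ∑ B : Finset V, (B.card : ℝ) *
      thSum {x // x ∈ B} (fun a => thSum {x // x ∉ B} (fun b => φ (a + b + B.card))) := by
  have e1 : ((Fintype.card V : ℝ) - 1) * thSum V φ =
      ∑ p : SimpleGraph V × V, ∑ v : V,
        if p.1.IsTree ∧ v ≠ p.2 then φ (∑ v, p.1.dist v p.2) else 0 := by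
    unfold thSum
    rw [Finset.mul_sum]
    refine Finset.sum_congr rfl ?_
    rintro ⟨G, r⟩ -
    by_cases hG : G.IsTree
    · simp only [hG, if_true, true_and]
      rw [← Finset.sum_filter, Finset.sum_const, Finset.filter_ne', Finset.card_erase_of_mem
        (Finset.mem_univ _), nsmul_eq_mul, Nat.cast_sub, Finset.card_univ]
      · simp
      · exact Fintype.card_pos_iff.2 ⟨r⟩
    · simp [hG]
  have e2 : ∀ (p : SimpleGraph V × V) (v : V),
      (if p.1.IsTree ∧ v ≠ p.2 then φ (∑ v, p.1.dist v p.2) else 0) =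
      ∑ q : Finset V × V, if p.1.IsTree ∧ (v ∈ q.1 ∧ q.2 ∈ q.1 ∧ p.2 ∉ q.1 ∧
        THCross p.1 (· ∈ q.1) q.2 p.2) then φ (∑ v, p.1.dist v p.2) else 0 := by
    rintro ⟨G, r⟩ v
    by_cases hG : G.IsTree
    · by_cases hv : v = r
      · subst hv
        simp only [ne_eq, not_true_eq_false, and_false, if_false]
        rw [Finset.sum_eq_zero]
        intro q _
        rw [if_neg]
        tauto
      · obtain ⟨q, hq, hq'⟩ := th_existsUnique_branch hG hv
        rw [if_pos ⟨hG, hv⟩, Finset.sum_eq_single q]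
        · rw [if_pos ⟨hG, hq⟩]
        · intro b _ hb
          rw [if_neg]
          exact fun h => hb (hq' b h.2)
        · simp
    · simp [hG]
  rw [e1]
  simp_rw [e2]
  rw [Finset.sum_congr rfl (fun p _ => Finset.sum_comm), Finset.sum_comm, Fintype.sum_prod_type]
  refine Finset.sum_congr rfl ?_
  intro B _
  have e3 : ∀ (u : V) (p : SimpleGraph V × V), (∑ v, if p.1.IsTree ∧ (v ∈ B ∧ u ∈ B ∧ p.2 ∉ B ∧
        THCross p.1 (· ∈ B) u p.2) then φ (∑ v, p.1.dist v p.2) else 0) = 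
      (B.card : ℝ) * if u ∈ B then if p.2 ∉ B then
       if (p.1.IsTree ∧ THCross p.1 (· ∈ B) u p.2) then φ (∑ v, p.1.dist v p.2) else 0 else 0 else 0 := by
    intro u p
    by_cases hu : u ∈ B
    · by_cases hr : p.2 ∈ B
      · simp [hr]
      · by_cases hc : p.1.IsTree ∧ THCross p.1 (· ∈ B) u p.2
        · simp only [hu, hr, hc]
          simp
        · rw [if_neg hc, Finset.sum_eq_zero]
          · simp
          · intro v _
            rw [if_neg]; tauto
    · simp [hu]
  simp_rw [e3, ← Finset.mul_sum]
  congr 1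
  have e4 : ∀ u : V, (∑ p : SimpleGraph V × V, if u ∈ B then if p.2 ∉ B then
       if (p.1.IsTree ∧ THCross p.1 (· ∈ B) u p.2) then φ (∑ v, p.1.dist v p.2) else 0 else 0 else 0)
      = if u ∈ B then ∑ r : V, if r ∉ B then ∑ G : SimpleGraph V,
       if (G.IsTree ∧ THCross G (· ∈ B) u r) then φ (∑ v, G.dist v r) else 0 else 0 else 0 := by
    intro u
    by_cases hu : u ∈ B
    · simp only [hu, if_true]
      rw [Fintype.sum_prod_type, Finset.sum_comm]
      refine Finset.sum_congr rfl fun r _ => ?_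
      by_cases hr : r ∉ B
      · simp only [hr, if_true, not_false_eq_true]
      · simp only [hr, if_false, Finset.sum_const_zero]
    · simp [hu]
  simp_rw [e4]
  rw [← Finset.sum_filter, Finset.sum_subtype (p := (· ∈ B)) _ (by simp)]
  have e5 : ∀ u : {x // x ∈ B}, (∑ r : V, if r ∉ B then ∑ G : SimpleGraph V,
       if (G.IsTree ∧ THCross G (· ∈ B) u r) then φ (∑ v, G.dist v r) else 0 else 0) = 
       ∑ r : {x // x ∉ B}, ∑ G : SimpleGraph V,
       if (G.IsTree ∧ THCross G (· ∈ B) u r) then φ (∑ v, G.dist v r) else 0 := by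
    intro u
    rw [← Finset.sum_filter, Finset.sum_subtype (p := (· ∉ B)) _ (by simp)]
  simp_rw [e5]
  rw [thSum_branch (· ∈ B) φ, Fintype.card_coe]
end Comb2

section Abel

theorem th_abel_uniq (p q : ℕ → ℝ → ℝ) (h0 : ∀ y, p 0 y = q 0 y)
    (hp : ∀ n y, HasDerivAt (p (n + 1)) ((n + 1) * p n (y + 1)) y)
    (hq : ∀ n y, HasDerivAt (q (n + 1)) ((n + 1) * q n (y + 1)) y)
    (hv : ∀ n : ℕ, p (n + 1) (-((n + 1 : ℕ) : ℝ)) = q (n + 1) (-((n + 1 : ℕ) : ℝ))) (n : ℕ) (y : ℝ) :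
    p n y = q n y := by
  induction n generalizing y with
  | zero => exact h0 y
  | succ n ih =>
    have hd : ∀ y, HasDerivAt (fun y => p (n + 1) y - q (n + 1) y) 0 y := by
      intro y
      have := (hp n y).sub (hq n y)
      rw [ih, sub_self] at this
      exact this
    have hc := is_const_of_deriv_eq_zero (f := fun y => p (n + 1) y - q (n + 1) y)
      (fun y => (hd y).differentiableAt) (fun y => (hd y).deriv) y (-((n + 1 : ℕ) : ℝ))
    simp only [hv, sub_self] at hc
    linarith

theorem th_abel_deriv (c : ℕ → ℝ) (n : ℕ) (y : ℝ) :
    HasDerivAt (fun y : ℝ => ∑ k ∈ Finset.range (n + 1 + 1),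
      ((n + 1).choose k : ℝ) * c k * (y + (n + 1 : ℕ) - k) ^ (n + 1 - k))
      ((n + 1) * ∑ k ∈ Finset.range (n + 1), (n.choose k : ℝ) * c k * (y + 1 + n - k) ^ (n - k)) y := by
  have h : HasDerivAt (fun y : ℝ => ∑ k ∈ Finset.range (n + 1 + 1),
      ((n + 1).choose k : ℝ) * c k * (y + (n + 1 : ℕ) - k) ^ (n + 1 - k))
      (∑ k ∈ Finset.range (n + 1 + 1),
      ((n + 1).choose k : ℝ) * c k * (((n + 1 - k : ℕ) : ℝ) * (y + (n + 1 : ℕ) - k) ^ (n + 1 - k - 1) * 1)) y := by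
    apply HasDerivAt.fun_sum
    intro k _
    apply HasDerivAt.const_mul
    apply HasDerivAt.fun_pow
    exact ((hasDerivAt_id y).add_const _).sub_const _
  convert h using 1
  rw [Finset.mul_sum, Finset.sum_range_succ _ (n + 1)]
  simp only [Nat.sub_self, Nat.cast_zero, zero_mul, mul_zero, add_zero]
  refine Finset.sum_congr rfl fun k hk => ?_
  have hk' : k ≤ n := by simpa [Nat.lt_succ_iff] using hk
  have h1 : (n.choose k : ℝ) * (n + 1) = ((n + 1).choose k : ℝ) * ((n + 1 - k : ℕ) : ℝ) := by
    exact_mod_cast Nat.choose_mul_succ_eq n k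
  have h2 : n + 1 - k - 1 = n - k := by omega
  rw [h2]
  have h3 : y + ((n + 1 : ℕ) : ℝ) - k = y + 1 + n - k := by push_cast; ring
  rw [h3]
  linear_combination (c k * (y + 1 + n - k) ^ (n - k)) * h1

theorem th_diff_pow (n m : ℕ) :
    ∑ k ∈ Finset.range (n + 1), (n.choose k : ℝ) * (-1) ^ (n - k) * (k : ℝ) ^ m =
      (fwdDiff (1 : ℝ))^[n] (fun x => x ^ m) 0 := by
  rw [fwdDiff_iter_eq_sum_shift]
  refine Finset.sum_congr rfl fun k _ => ?_
  rw [zsmul_eq_mul]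
  push_cast
  simp only [nsmul_eq_mul, mul_one, zero_add]
  ring

theorem th_abel1 (n : ℕ) (y : ℝ) :
    ∑ k ∈ Finset.range (n + 1), (n.choose k : ℝ) * ((k : ℝ) ^ k / k) * (y + n - k) ^ (n - k) =
      n * (y + n) ^ (n - 1) := by
  refine th_abel_uniq (fun n y => ∑ k ∈ Finset.range (n + 1), (n.choose k : ℝ) * ((k : ℝ) ^ k / k) * (y + n - k) ^ (n - k))
    (fun n y => n * (y + n) ^ (n - 1)) ?_ (th_abel_deriv _) ?_ ?_ n y
  · intro y; simp
  · intro n y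
    have h := (((hasDerivAt_id y).add_const ((n + 1 : ℕ) : ℝ)).fun_pow n).const_mul ((n + 1 : ℕ) : ℝ)
    have h2 : ((n + 1 : ℕ) : ℝ) * (n * (id y + ((n + 1 : ℕ) : ℝ)) ^ (n - 1) * 1) =
        (n + 1) * (n * (y + 1 + n) ^ (n - 1)) := by
      have : id y + ((n + 1 : ℕ) : ℝ) = y + 1 + n := by simp only [id]; push_cast; ring
      rw [this]; push_cast; ring
    rw [h2] at h
    exact h
  · intro n
    simp only [neg_add_cancel, Nat.add_sub_cancel]
    have : ∀ k ∈ Finset.range (n + 1 + 1), ((n + 1).choose k : ℝ) * ((k : ℝ) ^ k / k) *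
        (0 - (k : ℝ)) ^ (n + 1 - k)
        = ((n + 1).choose k : ℝ) * (-1) ^ (n + 1 - k) * (k : ℝ) ^ n - if k = 0 then (-1) ^ (n + 1) * 0 ^ n else 0 := by
      intro k hk
      have hk' : k ≤ n + 1 := by simpa [Nat.lt_succ_iff] using hk
      rcases Nat.eq_zero_or_pos k with rfl | hk0
      · simp
      · rw [if_neg hk0.ne', zero_sub, neg_pow]
        have : (k : ℝ) ^ k / k * (k : ℝ) ^ (n + 1 - k) = (k : ℝ) ^ n := by
          have hk1 : (k : ℝ) ≠ 0 := by positivity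
          field_simp
          rw [← pow_add, ← pow_succ']
          congr 1; omega
        linear_combination (((n + 1).choose k : ℝ) * (-1) ^ (n + 1 - k)) * this
    rw [Finset.sum_congr rfl this, Finset.sum_sub_distrib, th_diff_pow,
      fwdDiff_iter_pow_eq_zero_of_lt (Nat.lt_succ_self n)]
    simp
    rcases n with _ | n
    · simp
    · simp

theorem th_abel2 (n : ℕ) (y : ℝ) :
    ∑ k ∈ Finset.range (n + 1), (n.choose k : ℝ) * ((k : ℝ) ^ k) * (y + n - k) ^ (n - k) =
      ∑ k ∈ Finset.range (n + 1), (n.factorial : ℝ) / k.factorial * (y + n) ^ k := by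
  refine th_abel_uniq (fun n y => ∑ k ∈ Finset.range (n + 1), (n.choose k : ℝ) * ((k : ℝ) ^ k) * (y + n - k) ^ (n - k))
    (fun n y => ∑ k ∈ Finset.range (n + 1), (n.factorial : ℝ) / k.factorial * (y + n) ^ k) ?_ (th_abel_deriv _) ?_ ?_ n y
  · intro y; simp
  · intro n y
    have : HasDerivAt (fun y : ℝ => ∑ k ∈ Finset.range (n + 1 + 1), ((n + 1).factorial : ℝ) / k.factorial * (y + (n + 1 : ℕ)) ^ k)
        (∑ k ∈ Finset.range (n + 1 + 1), ((n + 1).factorial : ℝ) / k.factorial * (k * (y + (n + 1 : ℕ)) ^ (k - 1) * 1)) y := by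
      apply HasDerivAt.fun_sum
      intro k _
      apply HasDerivAt.const_mul
      apply HasDerivAt.fun_pow
      exact ((hasDerivAt_id y).add_const _)
    convert this using 1
    rw [Finset.mul_sum, Finset.sum_range_succ' _ (n + 1)]
    simp only [Nat.cast_zero, zero_mul, mul_zero, add_zero]
    refine Finset.sum_congr rfl fun k hk => ?_
    rw [Nat.factorial_succ, Nat.factorial_succ, Nat.add_sub_cancel]
    have h3 : y + ((n + 1 : ℕ) : ℝ) = y + 1 + n := by push_cast; ring
    rw [h3]
    push_cast
    have : (k.factorial : ℝ) ≠ 0 := by positivity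
    have : (k : ℝ) + 1 ≠ 0 := by positivity
    field_simp
  · intro n
    simp only [neg_add_cancel]
    have : ∀ k ∈ Finset.range (n + 1 + 1), ((n + 1).choose k : ℝ) * ((k : ℝ) ^ k) *
        (0 - (k : ℝ)) ^ (n + 1 - k)
        = ((n + 1).choose k : ℝ) * (-1) ^ (n + 1 - k) * (k : ℝ) ^ (n + 1) := by
      intro k hk
      have hk' : k ≤ n + 1 := by simpa [Nat.lt_succ_iff] using hk
      rw [zero_sub, neg_pow]
      have : (k : ℝ) ^ k * (k : ℝ) ^ (n + 1 - k) = (k : ℝ) ^ (n + 1) := by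
        rw [← pow_add]
        congr 1; omega
      linear_combination (((n + 1).choose k : ℝ) * (-1) ^ (n + 1 - k)) * this
    rw [Finset.sum_congr rfl this, th_diff_pow, fwdDiff_iter_eq_factorial, Finset.sum_range_succ']
    simp

end Abel

section PS
open PowerSeries

/-- Euler operator `x d/dx`. -/
noncomputable def thD (f : PowerSeries ℝ) : PowerSeries ℝ := PowerSeries.mk fun n => n * coeff n f

@[simp] theorem coeff_thD (f : PowerSeries ℝ) (n : ℕ) : coeff n (thD f) = n * coeff n f := by
  simp [thD]

theorem thD_add (f g : PowerSeries ℝ) : thD (f + g) = thD f + thD g := by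
  ext n; simp; ring
theorem thD_sub (f g : PowerSeries ℝ) : thD (f - g) = thD f - thD g := by
  ext n; simp; ring
theorem thD_one : thD 1 = 0 := by
  ext n
  rw [coeff_thD, coeff_one]
  split_ifs with h <;> simp [h]
theorem thD_mul (f g : PowerSeries ℝ) : thD (f * g) = thD f * g + f * thD g := by
  ext n
  rw [coeff_thD, map_add, coeff_mul, coeff_mul, coeff_mul, Finset.mul_sum, ← Finset.sum_add_distrib]
  refine Finset.sum_congr rfl fun p hp => ?_
  rw [Finset.HasAntidiagonal.mem_antidiagonal] at hp
  rw [coeff_thD, coeff_thD, ← hp]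
  push_cast; ring
theorem thD_nat_mul (c : ℕ) (f : PowerSeries ℝ) : thD (c * f) = c * thD f := by
  induction c with
  | zero => ext n; simp
  | succ c ih => push_cast; rw [add_mul, thD_add, ih]; ring
theorem thD_pow (f : PowerSeries ℝ) (m : ℕ) : thD (f ^ (m + 1)) = (m + 1) * f ^ m * thD f := by
  induction m with
  | zero => simp
  | succ m ih =>
    rw [pow_succ, thD_mul, ih]; push_cast; ring

theorem th_uniq (H A B : PowerSeries ℝ) (hA : coeff 0 A = 0) (hB : coeff 0 B = 0)
    (h : thD H - H = thD H * A + B * H) (h0 : coeff 0 H = 0) (h1 : coeff 1 H = 0) : H = 0 := by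
  ext n
  rw [map_zero]
  induction n using Nat.strong_induction_on with
  | _ n ih =>
    rcases n with _ | _ | n
    · exact h0
    · exact h1
    · have := congrArg (coeff (n + 2)) h
      rw [map_sub, map_add, coeff_thD, coeff_mul, coeff_mul, Finset.sum_eq_zero, Finset.sum_eq_zero] at this
      · have h2 : ((n : ℝ) + 1) * coeff (n + 2) H = 0 := by push_cast at this; linarith
        exact (mul_eq_zero.1 h2).resolve_left (by positivity)
      · rintro ⟨a, b⟩ hab
        rw [Finset.HasAntidiagonal.mem_antidiagonal] at hab
        simp only at hab ⊢
        rcases Nat.eq_zero_or_pos a with rfl | ha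
        · rw [hB, zero_mul]
        · rw [ih b (by omega), mul_zero]
      · rintro ⟨a, b⟩ hab
        rw [Finset.HasAntidiagonal.mem_antidiagonal] at hab
        simp only at hab ⊢
        rcases Nat.eq_zero_or_pos b with rfl | ha
        · rw [hA, mul_zero]
        · rw [coeff_thD, ih a (by omega), mul_zero, zero_mul]

noncomputable def thU : PowerSeries ℝ := PowerSeries.mk fun n => (n : ℝ) ^ n / n.factorial
noncomputable def thT : PowerSeries ℝ := PowerSeries.mk fun n => (n : ℝ) ^ n / n / n.factorial

theorem thD_T : thD thT = thU - 1 := by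
  ext n
  rw [coeff_thD, map_sub, coeff_one, thT, thU, coeff_mk, coeff_mk]
  rcases n with _ | n
  · simp
  · simp; field_simp

theorem th_TU : thT * thU = thU - 1 := by
  ext n
  rw [coeff_mul, Finset.Nat.sum_antidiagonal_eq_sum_range_succ_mk, map_sub, coeff_one, thT, thU]
  simp only [coeff_mk]
  have h := th_abel1 n 0
  have hf : (n.factorial : ℝ) ≠ 0 := by positivity
  have : ∀ k ∈ Finset.range n.succ, (k : ℝ) ^ k / k / k.factorial *
      (((n - k : ℕ) : ℝ) ^ (n - k) / (n - k).factorial) =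
      ((n.choose k : ℝ) * ((k : ℝ) ^ k / k) * (0 + n - k) ^ (n - k)) / n.factorial := by
    intro k hk
    have hk' : k ≤ n := by simpa [Nat.lt_succ_iff] using hk
    rw [Nat.cast_choose ℝ hk', Nat.cast_sub hk', zero_add]
    field_simp
  rw [Finset.sum_congr rfl this, ← Finset.sum_div, h]
  rcases n with _ | n
  · simp
  · simp [pow_succ']

theorem th_U2 (n : ℕ) : coeff n (thU ^ 2) = ∑ k ∈ Finset.range (n + 1), (n : ℝ) ^ k / k.factorial := by
  rw [pow_two, coeff_mul, Finset.Nat.sum_antidiagonal_eq_sum_range_succ_mk, thU]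
  simp only [coeff_mk]
  have h := th_abel2 n 0
  have hf : (n.factorial : ℝ) ≠ 0 := by positivity
  have : ∀ k ∈ Finset.range n.succ, (k : ℝ) ^ k / k.factorial *
      (((n - k : ℕ) : ℝ) ^ (n - k) / (n - k).factorial) =
      ((n.choose k : ℝ) * ((k : ℝ) ^ k) * (0 + n - k) ^ (n - k)) / n.factorial := by
    intro k hk
    have hk' : k ≤ n := by simpa [Nat.lt_succ_iff] using hk
    rw [Nat.cast_choose ℝ hk', Nat.cast_sub hk', zero_add]
    field_simp
  rw [Finset.sum_congr rfl this, ← Finset.sum_div, h, Finset.sum_div]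
  refine Finset.sum_congr rfl fun k _ => ?_
  rw [zero_add]
  field_simp

theorem thD_U : thD thU = thU ^ 3 - thU ^ 2 := by
  have h1 := congrArg thD th_TU
  rw [thD_mul, thD_sub, thD_one, thD_T] at h1
  have h2 := th_TU
  linear_combination thD thU * h2 - thU * h1

theorem th_U_rec (m n : ℕ) : coeff n (thU ^ (m + 3)) = coeff n (thU ^ (m + 2))
    + n / (m + 1) * coeff n (thU ^ (m + 1)) := by
  have h : thD (thU ^ (m + 1)) = ((m + 1 : ℕ) : PowerSeries ℝ) * (thU ^ (m + 3) - thU ^ (m + 2)) := by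
    rw [thD_pow, thD_U]; push_cast; ring
  have h2 := congrArg (coeff n) h
  rw [coeff_thD] at h2
  have h3 : coeff n (((m + 1 : ℕ) : PowerSeries ℝ) * (thU ^ (m + 3) - thU ^ (m + 2))) =
      ((m : ℝ) + 1) * (coeff n (thU ^ (m + 3)) - coeff n (thU ^ (m + 2))) := by
    rw [← map_natCast (C (R := ℝ)), coeff_C_mul, map_sub]; push_cast; rfl
  rw [h3] at h2
  have : (m : ℝ) + 1 ≠ 0 := by positivity
  field_simp
  linarith

end PS

section Mom
open PowerSeries

theorem thSum_sum {V ι : Type*} [Fintype V] (s : Finset ι) (f : ι → ℕ → ℝ) :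
    thSum V (fun a => ∑ i ∈ s, f i a) = ∑ i ∈ s, thSum V (f i) := by
  classical
  unfold thSum
  rw [Finset.sum_comm]
  refine Finset.sum_congr rfl fun p _ => ?_
  split_ifs <;> simp

theorem thSum_mul {V : Type*} [Fintype V] (c : ℝ) (f : ℕ → ℝ) :
    thSum V (fun a => c * f a) = c * thSum V f := by
  classical
  unfold thSum
  rw [Finset.mul_sum]
  refine Finset.sum_congr rfl fun p _ => ?_
  split_ifs <;> simp

theorem thSum_add_pow {V W : Type*} [Fintype V] [Fintype W] (k j : ℕ) :
    thSum V (fun a => thSum W (fun b => ((a + b + k : ℕ) : ℝ) ^ j)) =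
    ∑ i ∈ Finset.range (j + 1), ∑ m ∈ Finset.range (i + 1),
      (j.choose i : ℝ) * (i.choose m : ℝ) * ((k : ℝ) ^ (j - i) * thSum V (fun a => (a : ℝ) ^ m)) *
        thSum W (fun a => (a : ℝ) ^ (i - m)) := by
  have h : ∀ a b : ℕ, ((a + b + k : ℕ) : ℝ) ^ j = ∑ i ∈ Finset.range (j + 1),
      ∑ m ∈ Finset.range (i + 1),
      ((j.choose i : ℝ) * (i.choose m : ℝ) * (k : ℝ) ^ (j - i) * (a : ℝ) ^ m) * (b : ℝ) ^ (i - m) := by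
    intro a b
    push_cast
    rw [add_pow]
    refine Finset.sum_congr rfl fun i _ => ?_
    rw [add_pow, Finset.sum_mul, Finset.sum_mul]
    refine Finset.sum_congr rfl fun m _ => ?_
    ring
  simp_rw [h, thSum_sum, thSum_mul]
  refine Finset.sum_congr rfl fun i _ => Finset.sum_congr rfl fun m _ => ?_
  have : (fun a : ℕ => (j.choose i : ℝ) * (i.choose m : ℝ) * (k : ℝ) ^ (j - i) * (a : ℝ) ^ m *
      thSum W fun b => (b : ℝ) ^ (i - m)) = fun a : ℕ => ((j.choose i : ℝ) * (i.choose m : ℝ) *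
      (k : ℝ) ^ (j - i) * thSum W fun b => (b : ℝ) ^ (i - m)) * (a : ℝ) ^ m := by
    funext a; ring
  rw [this, thSum_mul]
  ring

theorem thSum_rec' {V : Type*} [Fintype V] [inst : DecidableEq V] (φ : ℕ → ℝ) :
    ((Fintype.card V : ℝ) - 1) * thSum V φ = ∑ B : Finset V, (B.card : ℝ) *
      thSum {x // x ∈ B} (fun a => thSum {x // x ∉ B} (fun b => φ (a + b + B.card))) := by
  have h : inst = fun a b => Classical.propDecidable (a = b) := Subsingleton.elim _ _
  subst h
  exact thSum_rec φ

noncomputable def thS (j n : ℕ) : ℝ := thSum (Fin n) (fun a => (a : ℝ) ^ j)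

theorem thS_rec (j n : ℕ) : ((n : ℝ) - 1) * thS j n =
    ∑ k ∈ Finset.range (n + 1), (n.choose k : ℝ) * (k *
    ∑ i ∈ Finset.range (j + 1), ∑ m ∈ Finset.range (i + 1),
      (j.choose i : ℝ) * (i.choose m : ℝ) * ((k : ℝ) ^ (j - i) * thS m k) * thS (i - m) (n - k)) := by
  have h := thSum_rec' (V := Fin n) (fun a => (a : ℝ) ^ j)
  rw [Fintype.card_fin] at h
  unfold thS
  rw [h]
  refine (Finset.sum_congr rfl (g := fun B : Finset (Fin n) => (fun k : ℕ => (k : ℝ) *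
    ∑ i ∈ Finset.range (j + 1), ∑ m ∈ Finset.range (i + 1),
      (j.choose i : ℝ) * (i.choose m : ℝ) * ((k : ℝ) ^ (j - i) * thS m k) * thS (i - m) (n - k))
      B.card) fun B _ => ?_).trans ?_
  · have e1 : {x // x ∈ B} ≃ Fin B.card := Fintype.equivFinOfCardEq (by simp)
    have e2 : {x // x ∉ B} ≃ Fin (n - B.card) := Fintype.equivFinOfCardEq (by
      rw [Fintype.card_subtype_compl]; simp)
    rw [thSum_add_pow]
    simp only [thS, thSum_congr e1, thSum_congr e2]
  · rw [← Finset.powerset_univ]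
    refine (Finset.sum_powerset_apply_card (fun k : ℕ => (k : ℝ) *
      ∑ i ∈ Finset.range (j + 1), ∑ m ∈ Finset.range (i + 1),
      (j.choose i : ℝ) * (i.choose m : ℝ) * ((k : ℝ) ^ (j - i) * thS m k) * thS (i - m) (n - k))).trans ?_
    simp only [Finset.card_univ, Fintype.card_fin, nsmul_eq_mul]
    rfl

theorem thS_zero (j : ℕ) : thS j 0 = 0 := by
  unfold thS thSum
  exact Finset.sum_of_isEmpty _

theorem thS_one (j : ℕ) : thS j 1 = 0 ^ j := by
  unfold thS
  rw [thSum_eq]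
  have h : ∀ G : SimpleGraph (Fin 1), G.IsTree := fun G => SimpleGraph.IsTree.of_subsingleton
  have h2 : ∀ (G : SimpleGraph (Fin 1)) (x y : Fin 1), G.dist x y = 0 := by
    intro G x y; rw [Subsingleton.elim x y]; simp
  simp [h, h2]

noncomputable def thF (j : ℕ) : PowerSeries ℝ := PowerSeries.mk fun n => thS j n / n.factorial

theorem coeff_thD_iter (f : PowerSeries ℝ) (i n : ℕ) :
    coeff n (thD^[i] f) = (n : ℝ) ^ i * coeff n f := by
  induction i with
  | zero => simp
  | succ i ih => rw [Function.iterate_succ_apply', coeff_thD, ih]; ring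

theorem thF_rec (j : ℕ) : thD (thF j) - thF j =
    ∑ i ∈ Finset.range (j + 1), ∑ m ∈ Finset.range (i + 1),
      ((j.choose i * i.choose m : ℕ) : PowerSeries ℝ) * (thD^[j - i + 1] (thF m) * thF (i - m)) := by
  ext n
  have hr := thS_rec j n
  have hf : (n.factorial : ℝ) ≠ 0 := by positivity
  rw [map_sub, coeff_thD, map_sum]
  simp_rw [map_sum, ← map_natCast (C (R := ℝ)), coeff_C_mul, coeff_mul,
    Finset.Nat.sum_antidiagonal_eq_sum_range_succ_mk, coeff_thD_iter]
  have h1 : (n : ℝ) * coeff n (thF j) - coeff n (thF j) = (((n : ℝ) - 1) * thS j n) / n.factorial := by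
    simp [thF]; ring
  rw [h1, hr, Finset.sum_div]
  simp_rw [Finset.mul_sum]
  rw [Finset.sum_congr rfl (fun i _ => Finset.sum_comm), Finset.sum_comm]
  refine Finset.sum_congr rfl fun k hk => ?_
  have hk' : k ≤ n := by simpa [Nat.lt_succ_iff] using hk
  rw [Finset.sum_div]
  refine Finset.sum_congr rfl fun i _ => ?_
  rw [Finset.sum_div]
  refine Finset.sum_congr rfl fun m _ => ?_
  simp only [thF, coeff_mk]
  rw [Nat.cast_choose ℝ hk']
  push_cast
  field_simp
  ring

theorem thF_coeff0 (j : ℕ) : coeff 0 (thF j) = 0 := by simp [thF, thS_zero]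
theorem thF_coeff1 (j : ℕ) : coeff 1 (thF j) = 0 ^ j := by simp [thF, thS_one]

theorem thU_coeff0 : coeff 0 thU = 1 := by simp [thU]
theorem thU_coeff1 : coeff 1 thU = 1 := by simp [thU]
theorem thT_coeff0 : coeff 0 thT = 0 := by simp [thT]
theorem thT_coeff1 : coeff 1 thT = 1 := by simp [thT]
theorem thU_pow_coeff0 (m : ℕ) : coeff 0 (thU ^ m) = 1 := by
  have := thU_coeff0
  simp only [coeff_zero_eq_constantCoeff] at this ⊢
  rw [map_pow, this, one_pow]
theorem thU_pow_coeff1 (m : ℕ) : coeff 1 (thU ^ m) = m := by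
  have h0 := thU_pow_coeff0 m
  have h1 := thU_coeff0
  simp only [coeff_zero_eq_constantCoeff] at h0 h1
  induction m with
  | zero => simp [coeff_one]
  | succ m ih =>
    have h2 := thU_pow_coeff0 m
    simp only [coeff_zero_eq_constantCoeff] at h2
    rw [pow_succ, coeff_one_mul, ih h2, h1, thU_coeff1, h2]
    push_cast; ring

theorem thD_ofNat (n : ℕ) [n.AtLeastTwo] : thD (ofNat(n) : PowerSeries ℝ) = 0 := by
  have h := thD_nat_mul (OfNat.ofNat n) 1
  rw [thD_one] at h
  simpa using h

theorem thF0 : thF 0 = thT := by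
  have h := thF_rec 0
  simp at h
  have hT : thD thT - thT = thD thT * thT := by
    rw [thD_T]; linear_combination - th_TU
  have : thF 0 - thT = 0 := by
    refine th_uniq _ (thF 0) (thD thT) (thF_coeff0 0) (by simp) ?_ ?_ ?_
    · rw [thD_sub]; linear_combination h - hT
    · rw [map_sub, thF_coeff0, thT_coeff0, sub_zero]
    · rw [map_sub, thF_coeff1, thT_coeff1]; simp
  exact sub_eq_zero.1 this

theorem th_cmul (n c : ℕ) [c.AtLeastTwo] (f : PowerSeries ℝ) :
    coeff n ((ofNat(c) : PowerSeries ℝ) * f) = (ofNat(c) : ℝ) * coeff n f := by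
  have : (ofNat(c) : PowerSeries ℝ) = C (ofNat(c) : ℝ) := (map_ofNat C c).symm
  rw [this, coeff_C_mul]
theorem th_c1 : coeff 0 (1 : PowerSeries ℝ) = 1 := by simp
theorem th_c1' : coeff 1 (1 : PowerSeries ℝ) = 0 := by simp [coeff_one]

theorem thDP_0_1 : thD (thU - 1) =
    thU ^ 3 - thU ^ 2 := by
  simp only [thD_add, thD_sub, thD_mul, thD_pow, thD_ofNat, thD_one, thD_U]
  push_cast
  ring

theorem thDP_0_2 : thD (thU ^ 3 - thU ^ 2) =
    3 * thU ^ 5 - 5 * thU ^ 4 + 2 * thU ^ 3 := by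
  simp only [thD_add, thD_sub, thD_mul, thD_pow, thD_ofNat, thD_one, thD_U]
  push_cast
  ring

theorem thDP_0_3 : thD (3 * thU ^ 5 - 5 * thU ^ 4 + 2 * thU ^ 3) =
    15 * thU ^ 7 - 35 * thU ^ 6 + 26 * thU ^ 5 - 6 * thU ^ 4 := by
  simp only [thD_add, thD_sub, thD_mul, thD_pow, thD_ofNat, thD_one, thD_U]
  push_cast
  ring

theorem thDP_0_4 : thD (15 * thU ^ 7 - 35 * thU ^ 6 + 26 * thU ^ 5 - 6 * thU ^ 4) =
    105 * thU ^ 9 - 315 * thU ^ 8 + 340 * thU ^ 7 - 154 * thU ^ 6 + 24 * thU ^ 5 := by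
  simp only [thD_add, thD_sub, thD_mul, thD_pow, thD_ofNat, thD_one, thD_U]
  push_cast
  ring

theorem thDP_1_0 : thD (thU ^ 2 - 2 * thU + 1) =
    2 * thU ^ 4 - 4 * thU ^ 3 + 2 * thU ^ 2 := by
  simp only [thD_add, thD_sub, thD_mul, thD_pow, thD_ofNat, thD_one, thD_U]
  push_cast
  ring

theorem thDP_1_1 : thD (2 * thU ^ 4 - 4 * thU ^ 3 + 2 * thU ^ 2) =
    8 * thU ^ 6 - 20 * thU ^ 5 + 16 * thU ^ 4 - 4 * thU ^ 3 := by
  simp only [thD_add, thD_sub, thD_mul, thD_pow, thD_ofNat, thD_one, thD_U]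
  push_cast
  ring

theorem thDP_1_2 : thD (8 * thU ^ 6 - 20 * thU ^ 5 + 16 * thU ^ 4 - 4 * thU ^ 3) =
    48 * thU ^ 8 - 148 * thU ^ 7 + 164 * thU ^ 6 - 76 * thU ^ 5 + 12 * thU ^ 4 := by
  simp only [thD_add, thD_sub, thD_mul, thD_pow, thD_ofNat, thD_one, thD_U]
  push_cast
  ring

theorem thDP_1_3 : thD (48 * thU ^ 8 - 148 * thU ^ 7 + 164 * thU ^ 6 - 76 * thU ^ 5 + 12 * thU ^ 4) =
    384 * thU ^ 10 - 1420 * thU ^ 9 + 2020 * thU ^ 8 - 1364 * thU ^ 7 + 428 * thU ^ 6 - 48 * thU ^ 5 := by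
  simp only [thD_add, thD_sub, thD_mul, thD_pow, thD_ofNat, thD_one, thD_U]
  push_cast
  ring

theorem thDP_2_0 : thD (5 * thU ^ 5 - 14 * thU ^ 4 + 13 * thU ^ 3 - 4 * thU ^ 2) =
    25 * thU ^ 7 - 81 * thU ^ 6 + 95 * thU ^ 5 - 47 * thU ^ 4 + 8 * thU ^ 3 := by
  simp only [thD_add, thD_sub, thD_mul, thD_pow, thD_ofNat, thD_one, thD_U]
  push_cast
  ring

theorem thDP_2_1 : thD (25 * thU ^ 7 - 81 * thU ^ 6 + 95 * thU ^ 5 - 47 * thU ^ 4 + 8 * thU ^ 3) =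
    175 * thU ^ 9 - 661 * thU ^ 8 + 961 * thU ^ 7 - 663 * thU ^ 6 + 212 * thU ^ 5 - 24 * thU ^ 4 := by
  simp only [thD_add, thD_sub, thD_mul, thD_pow, thD_ofNat, thD_one, thD_U]
  push_cast
  ring

theorem thDP_2_2 : thD (175 * thU ^ 9 - 661 * thU ^ 8 + 961 * thU ^ 7 - 663 * thU ^ 6 + 212 * thU ^ 5 - 24 * thU ^ 4) =
    1575 * thU ^ 11 - 6863 * thU ^ 10 + 12015 * thU ^ 9 - 10705 * thU ^ 8 + 5038 * thU ^ 7 - 1156 * thU ^ 6 + 96 * thU ^ 5 := by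
  simp only [thD_add, thD_sub, thD_mul, thD_pow, thD_ofNat, thD_one, thD_U]
  push_cast
  ring

theorem thDP_3_0 : thD (90 * thU ^ 8 - 353 * thU ^ 7 + 536 * thU ^ 6 - 389 * thU ^ 5 + 132 * thU ^ 4 - 16 * thU ^ 3) =
    720 * thU ^ 10 - 3191 * thU ^ 9 + 5687 * thU ^ 8 - 5161 * thU ^ 7 + 2473 * thU ^ 6 - 576 * thU ^ 5 + 48 * thU ^ 4 := by
  simp only [thD_add, thD_sub, thD_mul, thD_pow, thD_ofNat, thD_one, thD_U]
  push_cast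
  ring

theorem thDP_3_1 : thD (720 * thU ^ 10 - 3191 * thU ^ 9 + 5687 * thU ^ 8 - 5161 * thU ^ 7 + 2473 * thU ^ 6 - 576 * thU ^ 5 + 48 * thU ^ 4) =
    7200 * thU ^ 12 - 35919 * thU ^ 11 + 74215 * thU ^ 10 - 81623 * thU ^ 9 + 50965 * thU ^ 8 - 17718 * thU ^ 7 + 3072 * thU ^ 6 - 192 * thU ^ 5 := by
  simp only [thD_add, thD_sub, thD_mul, thD_pow, thD_ofNat, thD_one, thD_U]
  push_cast
  ring

theorem thDP_4_0 : thD (3315 * thU ^ 11 - 16771 * thU ^ 10 + 35171 * thU ^ 9 - 39290 * thU ^ 8 + 24926 * thU ^ 7 - 8797 * thU ^ 6 + 1542 * thU ^ 5 - 96 * thU ^ 4) =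
    36465 * thU ^ 13 - 204175 * thU ^ 12 + 484249 * thU ^ 11 - 630859 * thU ^ 10 + 488802 * thU ^ 9 - 227264 * thU ^ 8 + 60492 * thU ^ 7 - 8094 * thU ^ 6 + 384 * thU ^ 5 := by
  simp only [thD_add, thD_sub, thD_mul, thD_pow, thD_ofNat, thD_one, thD_U]
  push_cast
  ring

theorem thF_1 : thF 1 = thU ^ 2 - 2 * thU + 1 := by
  have h := thF_rec 1
  simp [Finset.sum_range_succ, Nat.choose_succ_succ] at h
  simp only [thF0] at h
  simp only [thD_T, thDP_0_1] at h
  have : thF 1 - (thU ^ 2 - 2 * thU + 1) = 0 := by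
    refine th_uniq _ thT (thD thT) thT_coeff0 (by simp) ?_ ?_ ?_
    · rw [thD_sub, thDP_1_0, thD_T]
      linear_combination h + (2 * thU ^ 3 - 3 * thU ^ 2 + thU) * th_TU
    · simp only [map_sub, map_add, thF_coeff0, th_cmul, thU_pow_coeff0, thU_coeff0, th_c1]
      norm_num
    · simp only [map_sub, map_add, thF_coeff1, th_cmul, thU_pow_coeff1, thU_coeff1, th_c1']
      norm_num
  exact sub_eq_zero.1 this

theorem thF_2 : thF 2 = 5 * thU ^ 5 - 14 * thU ^ 4 + 13 * thU ^ 3 - 4 * thU ^ 2 := by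
  have h := thF_rec 2
  simp [Finset.sum_range_succ, Nat.choose_succ_succ] at h
  simp only [thF0, thF_1] at h
  simp only [thD_T, thDP_0_1, thDP_0_2, thDP_1_0, thDP_1_1] at h
  have : thF 2 - (5 * thU ^ 5 - 14 * thU ^ 4 + 13 * thU ^ 3 - 4 * thU ^ 2) = 0 := by
    refine th_uniq _ thT (thD thT) thT_coeff0 (by simp) ?_ ?_ ?_
    · rw [thD_sub, thDP_2_0, thD_T]
      linear_combination h + (25 * thU ^ 6 - 65 * thU ^ 5 + 58 * thU ^ 4 - 20 * thU ^ 3 + 2 * thU ^ 2) * th_TU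
    · simp only [map_sub, map_add, thF_coeff0, th_cmul, thU_pow_coeff0, thU_coeff0, th_c1]
      norm_num
    · simp only [map_sub, map_add, thF_coeff1, th_cmul, thU_pow_coeff1, thU_coeff1, th_c1']
      norm_num
  exact sub_eq_zero.1 this

theorem thF_3 : thF 3 = 90 * thU ^ 8 - 353 * thU ^ 7 + 536 * thU ^ 6 - 389 * thU ^ 5 + 132 * thU ^ 4 - 16 * thU ^ 3 := by
  have h := thF_rec 3
  simp [Finset.sum_range_succ, Nat.choose_succ_succ] at h
  simp only [thF0, thF_1, thF_2] at h
  simp only [thD_T, thDP_0_1, thDP_0_2, thDP_0_3, thDP_1_0, thDP_1_1, thDP_1_2, thDP_2_0, thDP_2_1] at h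
  have : thF 3 - (90 * thU ^ 8 - 353 * thU ^ 7 + 536 * thU ^ 6 - 389 * thU ^ 5 + 132 * thU ^ 4 - 16 * thU ^ 3) = 0 := by
    refine th_uniq _ thT (thD thT) thT_coeff0 (by simp) ?_ ?_ ?_
    · rw [thD_sub, thDP_3_0, thD_T]
      linear_combination h + (720 * thU ^ 9 - 2666 * thU ^ 8 + 3848 * thU ^ 7 - 2707 * thU ^ 6 + 941 * thU ^ 5 - 142 * thU ^ 4 + 6 * thU ^ 3) * th_TU
    · simp only [map_sub, map_add, thF_coeff0, th_cmul, thU_pow_coeff0, thU_coeff0, th_c1]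
      norm_num
    · simp only [map_sub, map_add, thF_coeff1, th_cmul, thU_pow_coeff1, thU_coeff1, th_c1']
      norm_num
  exact sub_eq_zero.1 this

theorem thF_4 : thF 4 = 3315 * thU ^ 11 - 16771 * thU ^ 10 + 35171 * thU ^ 9 - 39290 * thU ^ 8 + 24926 * thU ^ 7 - 8797 * thU ^ 6 + 1542 * thU ^ 5 - 96 * thU ^ 4 := by
  have h := thF_rec 4
  simp [Finset.sum_range_succ, Nat.choose_succ_succ] at h
  simp only [thF0, thF_1, thF_2, thF_3] at h
  simp only [thD_T, thDP_0_1, thDP_0_2, thDP_0_3, thDP_0_4, thDP_1_0, thDP_1_1, thDP_1_2, thDP_1_3, thDP_2_0, thDP_2_1, thDP_2_2, thDP_3_0, thDP_3_1] at h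
  have : thF 4 - (3315 * thU ^ 11 - 16771 * thU ^ 10 + 35171 * thU ^ 9 - 39290 * thU ^ 8 + 24926 * thU ^ 7 - 8797 * thU ^ 6 + 1542 * thU ^ 5 - 96 * thU ^ 4) = 0 := by
    refine th_uniq _ thT (thD thT) thT_coeff0 (by simp) ?_ ?_ ?_
    · rw [thD_sub, thDP_4_0, thD_T]
      linear_combination h + (36465 * thU ^ 12 - 175375 * thU ^ 11 + 350023 * thU ^ 10 - 373641 * thU ^ 9 + 228825 * thU ^ 8 - 79869 * thU ^ 7 + 14732 * thU ^ 6 - 1184 * thU ^ 5 + 24 * thU ^ 4) * th_TU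
    · simp only [map_sub, map_add, thF_coeff0, th_cmul, thU_pow_coeff0, thU_coeff0, th_c1]
      norm_num
    · simp only [map_sub, map_add, thF_coeff1, th_cmul, thU_pow_coeff1, thU_coeff1, th_c1']
      norm_num
  exact sub_eq_zero.1 this

end Mom

section Asym
open PowerSeries Filter MeasureTheory Set

theorem th_log_le {y : ℝ} (hy : 1 ≤ y) : Real.log y ≤ (y - y⁻¹) / 2 := by
  have h := (Real.self_le_sinh_iff (x := Real.log y)).2 (Real.log_nonneg hy)
  rwa [Real.sinh_eq, Real.exp_neg, Real.exp_log (by linarith)] at h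

theorem th_exp_form {t s : ℝ} (n : ℕ) (hn : (n : ℝ) = t ^ 2) (ht : 0 < t) (hs : 0 < s) :
    Real.exp (-t * s) * (1 + s / t) ^ n = Real.exp (t ^ 2 * Real.log (1 + s / t) - t * s) := by
  have hp : 0 < 1 + s / t := by positivity
  rw [Real.exp_sub, ← hn, ← Real.log_pow, Real.exp_log (by positivity), neg_mul, Real.exp_neg]
  ring

theorem th_exp_upper {t s : ℝ} (ht : 0 < t) (hs : 0 < s) :
    t ^ 2 * Real.log (1 + s / t) - t * s ≤ - s ^ 2 * t / (2 * (t + s)) := by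
  have hx : 0 < s / t := by positivity
  have h := th_log_le (y := 1 + s / t) (by linarith)
  have h2 : t ^ 2 * Real.log (1 + s / t) ≤ t ^ 2 * ((1 + s / t - (1 + s / t)⁻¹) / 2) := by gcongr
  have h3 : t ^ 2 * ((1 + s / t - (1 + s / t)⁻¹) / 2) - t * s = - s ^ 2 * t / (2 * (t + s)) := by
    have : 1 + s / t = (t + s) / t := by field_simp
    rw [this]
    have : t + s ≠ 0 := by positivity
    field_simp
    ring
  linarith

theorem th_exp_lower {t s : ℝ} (ht : 0 < t) (hs : 0 < s) :
    - s ^ 2 * t / (s + 2 * t) ≤ t ^ 2 * Real.log (1 + s / t) - t * s := by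
  have hx : 0 < s / t := by positivity
  have h := Real.le_log_one_add_of_nonneg hx.le
  have h2 : t ^ 2 * (2 * (s / t) / (s / t + 2)) ≤ t ^ 2 * Real.log (1 + s / t) := by gcongr
  have h3 : t ^ 2 * (2 * (s / t) / (s / t + 2)) - t * s = - s ^ 2 * t / (s + 2 * t) := by
    have : s / t + 2 = (s + 2 * t) / t := by field_simp
    rw [this]
    have : s + 2 * t ≠ 0 := by positivity
    field_simp
    ring
  linarith

theorem th_exp_dom {t s : ℝ} (ht : 1 ≤ t) (hs : 0 < s) :
    - s ^ 2 * t / (2 * (t + s)) ≤ 1 / 2 + (- (1 / 2) * s) := by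
  rw [div_le_iff₀ (by linarith)]
  nlinarith [mul_nonneg (sub_nonneg.2 ht) (by nlinarith [sq_nonneg (s - 1 / 2)] : (0:ℝ) ≤ s ^ 2 - s + 1)]

theorem th_tendsto_sqrt : Tendsto (fun n : ℕ => √(n : ℝ)) atTop atTop :=
  Real.tendsto_sqrt_atTop.comp tendsto_natCast_atTop_atTop

theorem th_integral_lim : Tendsto (fun n : ℕ => ∫ s in Ioi (0 : ℝ),
    Real.exp (-√(n : ℝ) * s) * (1 + s / √(n : ℝ)) ^ n) atTop (nhds (√(Real.pi / 2))) := by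
  have hg : ∫ s in Ioi (0 : ℝ), Real.exp (-(1 / 2) * s ^ 2) = √(Real.pi / 2) := by
    rw [integral_gaussian_Ioi]
    have : Real.pi / (1 / 2) = (Real.pi / 2) * 2 ^ 2 := by ring
    rw [this, Real.sqrt_mul (by positivity), Real.sqrt_sq (by norm_num)]
    ring
  rw [← hg]
  refine tendsto_integral_filter_of_dominated_convergence
    (fun s => Real.exp (1 / 2) * Real.exp (-(1 / 2) * s)) ?_ ?_ ?_ ?_
  · refine Eventually.of_forall fun n => ?_
    apply Measurable.aestronglyMeasurable
    fun_prop
  · filter_upwards [eventually_ge_atTop 1] with n hn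
    have ht : 1 ≤ √(n : ℝ) := by
      rw [Real.one_le_sqrt]; exact_mod_cast hn
    refine (ae_restrict_mem measurableSet_Ioi).mono fun s hs => ?_
    have hs : 0 < s := hs
    rw [th_exp_form n (Real.sq_sqrt (Nat.cast_nonneg n)).symm (by linarith) hs, ← Real.exp_add,
      Real.norm_eq_abs, Real.abs_exp]
    exact Real.exp_le_exp.2 ((th_exp_upper (by linarith) hs).trans (th_exp_dom ht hs))
  · exact ((exp_neg_integrableOn_Ioi 0 (by norm_num))).const_mul _
  · refine (ae_restrict_mem measurableSet_Ioi).mono fun s hs => ?_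
    have hs : 0 < s := hs
    have hi : Tendsto (fun n : ℕ => s / √(n : ℝ)) atTop (nhds 0) :=
      th_tendsto_sqrt.const_div_atTop s
    have hl : Tendsto (fun n : ℕ => - s ^ 2 / (s / √(n : ℝ) + 2)) atTop (nhds (- (1 / 2) * s ^ 2)) := by
      have := (tendsto_const_nhds (x := - s ^ 2)).div (hi.add_const 2) (by norm_num)
      rw [show -(1 / 2) * s ^ 2 = - s ^ 2 / (0 + 2) by ring]
      exact this
    have hu : Tendsto (fun n : ℕ => - s ^ 2 / (2 * (1 + s / √(n : ℝ)))) atTop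
        (nhds (- (1 / 2) * s ^ 2)) := by
      have := (tendsto_const_nhds (x := - s ^ 2)).div ((hi.const_add 1).const_mul 2) (by norm_num)
      rw [show -(1 / 2) * s ^ 2 = - s ^ 2 / (2 * (1 + 0)) by ring]
      exact this
    have hm : Tendsto (fun n : ℕ => √(n : ℝ) ^ 2 * Real.log (1 + s / √(n : ℝ)) - √(n : ℝ) * s) atTop
        (nhds (- (1 / 2) * s ^ 2)) := by
      refine tendsto_of_tendsto_of_tendsto_of_le_of_le' hl hu ?_ ?_
      · filter_upwards [eventually_ge_atTop 1] with n hn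
        have ht : 0 < √(n : ℝ) := by
          rw [Real.sqrt_pos]; exact_mod_cast hn
        refine le_trans (le_of_eq ?_) (th_exp_lower ht hs)
        field_simp
      · filter_upwards [eventually_ge_atTop 1] with n hn
        have ht : 0 < √(n : ℝ) := by
          rw [Real.sqrt_pos]; exact_mod_cast hn
        refine (th_exp_upper ht hs).trans (le_of_eq ?_)
        field_simp
    refine ((Real.continuous_exp.tendsto _).comp hm).congr' ?_
    filter_upwards [eventually_ge_atTop 1] with n hn
    have ht : 0 < √(n : ℝ) := by
      rw [Real.sqrt_pos]; exact_mod_cast hn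
    exact (th_exp_form n (Real.sq_sqrt (Nat.cast_nonneg n)).symm ht hs).symm

theorem th_gamma_int {t : ℝ} (ht : 0 < t) (j : ℕ) :
    IntegrableOn (fun s : ℝ => s ^ j * Real.exp (-t * s)) (Ioi 0) ∧
    ∫ s in Ioi (0 : ℝ), s ^ j * Real.exp (-t * s) = j.factorial / t ^ (j + 1) := by
  constructor
  · have := integrableOn_rpow_mul_exp_neg_mul_rpow (p := 1) (s := (j : ℝ)) (b := t)
      (by have : (0:ℝ) ≤ j := Nat.cast_nonneg j
          linarith) one_pos ht
    simpa using this
  · have := Real.integral_rpow_mul_exp_neg_mul_Ioi (a := (j : ℝ) + 1) (r := t) (by positivity) ht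
    simp only [add_sub_cancel_right, Real.rpow_natCast, Real.Gamma_nat_eq_factorial] at this
    have h2 : (1 / t) ^ ((j : ℝ) + 1) = (1 / t) ^ (j + 1) := by
      rw [← Real.rpow_natCast]; push_cast; rfl
    rw [h2] at this
    simp only [neg_mul]
    rw [this]
    simp [div_eq_mul_inv, mul_comm]

theorem th_integral_eq (n : ℕ) (hn : 1 ≤ n) : ∫ s in Ioi (0 : ℝ),
    Real.exp (-√(n : ℝ) * s) * (1 + s / √(n : ℝ)) ^ n =
      coeff n (thU ^ 2) / (coeff n thU * √(n : ℝ)) := by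
  have ht : 0 < √(n : ℝ) := by
    rw [Real.sqrt_pos]; exact_mod_cast hn
  have hsq : √(n : ℝ) ^ 2 = n := Real.sq_sqrt (Nat.cast_nonneg n)
  rw [th_U2]
  have hc : coeff n thU = (n : ℝ) ^ n / n.factorial := by simp [thU]
  rw [hc]
  generalize √(n : ℝ) = t at *
  have h1 : ∀ s : ℝ, Real.exp (-t * s) * (1 + s / t) ^ n = ∑ k ∈ Finset.range (n + 1),
      (n.choose k / t ^ (n - k)) * (s ^ (n - k) * Real.exp (-t * s)) := by
    intro s
    rw [add_pow, Finset.mul_sum]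
    refine Finset.sum_congr rfl fun k _ => ?_
    rw [one_pow, div_pow]
    ring
  simp_rw [h1]
  rw [integral_finset_sum _ (fun k _ => ((th_gamma_int ht (n - k)).1).const_mul _), Finset.sum_div]
  refine Finset.sum_congr rfl fun k hk => ?_
  rw [integral_const_mul, (th_gamma_int ht (n - k)).2]
  have hk' : k ≤ n := by simpa [Nat.lt_succ_iff] using hk
  rw [Nat.cast_choose ℝ hk', ← hsq]
  obtain ⟨d, rfl⟩ := Nat.exists_eq_add_of_le hk'
  have e : k + d - k = d := by omega
  rw [e]
  field_simp
  ring

theorem th_L2 : Tendsto (fun n : ℕ => coeff n (thU ^ 2) / (coeff n thU * √(n : ℝ))) atTop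
    (nhds (√(Real.pi / 2))) := by
  refine th_integral_lim.congr' ?_
  filter_upwards [eventually_ge_atTop 1] with n hn
  exact th_integral_eq n hn

/-- Scaled coefficients of powers of `thU`. -/
noncomputable def thR (m n : ℕ) : ℝ := coeff n (thU ^ (m + 1)) / (coeff n thU * √(n : ℝ) ^ m)

theorem thU_coeff_pos (n : ℕ) (hn : 1 ≤ n) : 0 < coeff n thU := by
  have : (0:ℝ) < n := by exact_mod_cast hn
  simp only [thU, coeff_mk]
  positivity

theorem thR_rec (m n : ℕ) (hn : 1 ≤ n) :
    thR (m + 2) n = thR (m + 1) n * (1 / √(n : ℝ)) + thR m n / (m + 1) := by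
  have ht : 0 < √(n : ℝ) := by
    rw [Real.sqrt_pos]; exact_mod_cast hn
  have hsq : √(n : ℝ) ^ 2 = n := Real.sq_sqrt (Nat.cast_nonneg n)
  have hc := thU_coeff_pos n hn
  unfold thR
  rw [th_U_rec]
  have : (m : ℝ) + 1 ≠ 0 := by positivity
  generalize coeff n (thU ^ (m + 2)) = a
  have e : thU ^ (m + 1 + 1) = thU ^ (m + 2) := rfl
  generalize coeff n (thU ^ (m + 1)) = b
  generalize coeff n thU = c at *
  generalize √(n : ℝ) = t at *
  rw [← hsq]
  field_simp
  ring

/-- The limits of the scaled coefficients. -/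
noncomputable def thL : ℕ → ℝ
  | 0 => 1
  | 1 => √(Real.pi / 2)
  | m + 2 => thL m / (m + 1)

theorem thR_lim (m : ℕ) : Tendsto (thR m) atTop (nhds (thL m)) := by
  induction m using Nat.strong_induction_on with
  | _ m ih =>
    match m, ih with
    | 0, _ =>
      refine tendsto_const_nhds.congr' ?_
      filter_upwards [eventually_ge_atTop 1] with n hn
      have hc := thU_coeff_pos n hn
      simp [thR, thL, hc.ne']
    | 1, _ =>
      refine th_L2.congr fun n => ?_
      simp [thR]
    | m + 2, ih =>
      have hi : Tendsto (fun n : ℕ => 1 / √(n : ℝ)) atTop (nhds 0) :=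
        th_tendsto_sqrt.const_div_atTop 1
      have h := ((ih (m + 1) (by omega)).mul hi).add ((ih m (by omega)).div_const ((m : ℝ) + 1))
      rw [mul_zero, zero_add] at h
      refine h.congr' ?_
      filter_upwards [eventually_ge_atTop 1] with n hn
      exact (thR_rec m n hn).symm

/-- Higher normalisation kills the term. -/
theorem thR_zero (m k : ℕ) : Tendsto (fun n : ℕ => thR m n * (1 / √(n : ℝ)) ^ (k + 1)) atTop (nhds 0) := by
  have hi : Tendsto (fun n : ℕ => 1 / √(n : ℝ)) atTop (nhds 0) :=
    th_tendsto_sqrt.const_div_atTop 1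
  have := (thR_lim m).mul (hi.pow (k + 1))
  simpa using this

/-- The scaled raw moments. -/
noncomputable def thE (j n : ℕ) : ℝ := thS j n / thS 0 n / √(n : ℝ) ^ (3 * j)

theorem thE_eq (j n : ℕ) (hn : 1 ≤ n) :
    thE j n = coeff n (thF j) / (coeff n thU * √(n : ℝ) ^ (3 * j)) * √(n : ℝ) ^ 2 := by
  have hsq : √(n : ℝ) ^ 2 = n := Real.sq_sqrt (Nat.cast_nonneg n)
  have hn' : (0:ℝ) < n := by exact_mod_cast hn
  have h0 : thS 0 n = (n : ℝ) ^ n / n := by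
    have := congrArg (coeff n) thF0
    simp only [thF, thT, coeff_mk] at this
    field_simp at this ⊢
    linarith
  unfold thE
  rw [h0, hsq]
  simp only [thF, thU, coeff_mk]
  field_simp

theorem thM_1 : Tendsto (thE 1) atTop (nhds (√(Real.pi / 2))) := by
  have h := ((thR_lim 1).sub ((thR_zero 0 0).const_mul 2))
  have hl : thL 1 = thL 1 := rfl
  conv_rhs at hl => simp only [thL]
  rw [hl] at h
  refine Tendsto.congr' ?_ (h.trans_eq ?_)
  · filter_upwards [eventually_ge_atTop 1] with n hn
    have ht : 0 < √(n : ℝ) := by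
      rw [Real.sqrt_pos]; exact_mod_cast hn
    have hc := thU_coeff_pos n hn
    rw [thE_eq 1 n hn, thF_1]
    simp only [map_sub, map_add, th_cmul, thR, zero_add, pow_one, Nat.reduceAdd, Nat.reduceMul]
    rw [show coeff n (1 : PowerSeries ℝ) = 0 by simp [coeff_one]; omega]
    generalize coeff n (thU ^ 2) = a2
    generalize coeff n thU = c at *
    generalize √(n : ℝ) = t at *
    field_simp
    ring
  · congr 1
    norm_num
    try ring

theorem thM_2 : Tendsto (thE 2) atTop (nhds (5 / 3)) := by
  have h := (((((thR_lim 4).const_mul 5).sub ((thR_zero 3 0).const_mul 14)).add ((thR_zero 2 1).const_mul 13)).sub ((thR_zero 1 2).const_mul 4))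
  have hl : thL 4 = thL 4 := rfl
  conv_rhs at hl => simp only [thL]
  rw [hl] at h
  refine Tendsto.congr' ?_ (h.trans_eq ?_)
  · filter_upwards [eventually_ge_atTop 1] with n hn
    have ht : 0 < √(n : ℝ) := by
      rw [Real.sqrt_pos]; exact_mod_cast hn
    have hc := thU_coeff_pos n hn
    rw [thE_eq 2 n hn, thF_2]
    simp only [map_sub, map_add, th_cmul, thR, zero_add, pow_one, Nat.reduceAdd, Nat.reduceMul]
    skip
    generalize coeff n (thU ^ 5) = a5
    generalize coeff n (thU ^ 4) = a4
    generalize coeff n (thU ^ 3) = a3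
    generalize coeff n (thU ^ 2) = a2
    generalize coeff n thU = c at *
    generalize √(n : ℝ) = t at *
    field_simp
    skip
  · congr 1
    norm_num
    try ring

theorem thM_3 : Tendsto (thE 3) atTop (nhds (15 / 8 * √(Real.pi / 2))) := by
  have h := (((((((thR_lim 7).const_mul 90).sub ((thR_zero 6 0).const_mul 353)).add ((thR_zero 5 1).const_mul 536)).sub ((thR_zero 4 2).const_mul 389)).add ((thR_zero 3 3).const_mul 132)).sub ((thR_zero 2 4).const_mul 16))
  have hl : thL 7 = thL 7 := rfl
  conv_rhs at hl => simp only [thL]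
  rw [hl] at h
  refine Tendsto.congr' ?_ (h.trans_eq ?_)
  · filter_upwards [eventually_ge_atTop 1] with n hn
    have ht : 0 < √(n : ℝ) := by
      rw [Real.sqrt_pos]; exact_mod_cast hn
    have hc := thU_coeff_pos n hn
    rw [thE_eq 3 n hn, thF_3]
    simp only [map_sub, map_add, th_cmul, thR, zero_add, pow_one, Nat.reduceAdd, Nat.reduceMul]
    skip
    generalize coeff n (thU ^ 8) = a8
    generalize coeff n (thU ^ 7) = a7
    generalize coeff n (thU ^ 6) = a6
    generalize coeff n (thU ^ 5) = a5
    generalize coeff n (thU ^ 4) = a4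
    generalize coeff n (thU ^ 3) = a3
    generalize coeff n thU = c at *
    generalize √(n : ℝ) = t at *
    field_simp
    skip
  · congr 1
    norm_num
    try ring

theorem thM_4 : Tendsto (thE 4) atTop (nhds (221 / 63)) := by
  have h := (((((((((thR_lim 10).const_mul 3315).sub ((thR_zero 9 0).const_mul 16771)).add ((thR_zero 8 1).const_mul 35171)).sub ((thR_zero 7 2).const_mul 39290)).add ((thR_zero 6 3).const_mul 24926)).sub ((thR_zero 5 4).const_mul 8797)).add ((thR_zero 4 5).const_mul 1542)).sub ((thR_zero 3 6).const_mul 96))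
  have hl : thL 10 = thL 10 := rfl
  conv_rhs at hl => simp only [thL]
  rw [hl] at h
  refine Tendsto.congr' ?_ (h.trans_eq ?_)
  · filter_upwards [eventually_ge_atTop 1] with n hn
    have ht : 0 < √(n : ℝ) := by
      rw [Real.sqrt_pos]; exact_mod_cast hn
    have hc := thU_coeff_pos n hn
    rw [thE_eq 4 n hn, thF_4]
    simp only [map_sub, map_add, th_cmul, thR, zero_add, pow_one, Nat.reduceAdd, Nat.reduceMul]
    skip
    generalize coeff n (thU ^ 11) = a11
    generalize coeff n (thU ^ 10) = a10
    generalize coeff n (thU ^ 9) = a9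
    generalize coeff n (thU ^ 8) = a8
    generalize coeff n (thU ^ 7) = a7
    generalize coeff n (thU ^ 6) = a6
    generalize coeff n (thU ^ 5) = a5
    generalize coeff n (thU ^ 4) = a4
    generalize coeff n thU = c at *
    generalize √(n : ℝ) = t at *
    field_simp
    skip
  · congr 1
    norm_num
    try ring

end Asym

section Fin
open Filter

theorem th_bridge (n : ℕ) (φ : ℕ → ℝ) :
    ∑ p ∈ RootedLabeledTrees n, φ (rlTotalHeight n p) = thSum (Fin n) φ := by
  unfold RootedLabeledTrees thSum rlTotalHeight
  rw [Finset.sum_filter]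
  refine Finset.sum_congr (by congr!) fun p _ => ?_
  congr!

theorem th_card (n : ℕ) : ((RootedLabeledTrees n).card : ℝ) = thS 0 n := by
  unfold thS
  rw [← th_bridge]
  simp

theorem th_moment (j n : ℕ) : ∑ p ∈ RootedLabeledTrees n, (rlTotalHeight n p : ℝ) ^ j = thS j n := by
  unfold thS
  rw [← th_bridge]

theorem th_rlMu (n : ℕ) : rlMu n = thS 1 n / thS 0 n := by
  unfold rlMu
  rw [th_card, ← th_moment 1]
  simp

theorem th_S0_pos (n : ℕ) (hn : 1 ≤ n) : 0 < thS 0 n := by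
  have hn' : (0:ℝ) < n := by exact_mod_cast hn
  have h0 : thS 0 n = (n : ℝ) ^ n / n := by
    have := congrArg (PowerSeries.coeff n) thF0
    simp only [thF, thT, PowerSeries.coeff_mk] at this
    field_simp at this ⊢
    linarith
  rw [h0]; positivity

theorem th_cm2 (n : ℕ) (hn : 1 ≤ n) :
    rlCentralMoment 2 n = (thE 2 n - thE 1 n ^ 2) * √(n : ℝ) ^ 6 := by
  have h0 := th_S0_pos n hn
  have ht : 0 < √(n : ℝ) := by
    rw [Real.sqrt_pos]; exact_mod_cast hn
  unfold rlCentralMoment thE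
  rw [th_card, th_rlMu]
  generalize hm : thS 1 n / thS 0 n = m
  have h1 : thS 1 n = m * thS 0 n := by rw [← hm]; field_simp
  have e : ∑ p ∈ RootedLabeledTrees n, ((rlTotalHeight n p : ℝ) - m) ^ 2 =
      thS 2 n - 2 * m * thS 1 n + m ^ 2 * thS 0 n := by
    simp only [← th_moment, Finset.mul_sum, ← Finset.sum_add_distrib, ← Finset.sum_sub_distrib]
    exact Finset.sum_congr rfl fun p _ => by ring
  rw [e, h1]
  field_simp
  ring

theorem th_cm4 (n : ℕ) (hn : 1 ≤ n) :
    rlCentralMoment 4 n = (thE 4 n - 4 * thE 3 n * thE 1 n + 6 * thE 2 n * thE 1 n ^ 2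
      - 3 * thE 1 n ^ 4) * √(n : ℝ) ^ 12 := by
  have h0 := th_S0_pos n hn
  have ht : 0 < √(n : ℝ) := by
    rw [Real.sqrt_pos]; exact_mod_cast hn
  unfold rlCentralMoment thE
  rw [th_card, th_rlMu]
  generalize hm : thS 1 n / thS 0 n = m
  have h1 : thS 1 n = m * thS 0 n := by rw [← hm]; field_simp
  have e : ∑ p ∈ RootedLabeledTrees n, ((rlTotalHeight n p : ℝ) - m) ^ 4 =
      thS 4 n - 4 * m * thS 3 n + 6 * m ^ 2 * thS 2 n - 4 * m ^ 3 * thS 1 n + m ^ 4 * thS 0 n := by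
    simp only [← th_moment, Finset.mul_sum, ← Finset.sum_add_distrib, ← Finset.sum_sub_distrib]
    exact Finset.sum_congr rfl fun p _ => by ring
  rw [e, h1]
  field_simp
  ring

theorem th_alpha (n : ℕ) (hn : 1 ≤ n) :
    rlAlpha 4 n = (thE 4 n - 4 * thE 3 n * thE 1 n + 6 * thE 2 n * thE 1 n ^ 2
      - 3 * thE 1 n ^ 4) / (thE 2 n - thE 1 n ^ 2) ^ 2 := by
  have ht : 0 < √(n : ℝ) := by
    rw [Real.sqrt_pos]; exact_mod_cast hn
  unfold rlAlpha
  rw [show (((4 : ℕ) : ℝ) / 2) = ((2 : ℕ) : ℝ) by norm_num, Real.rpow_natCast, th_cm2 n hn,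
    th_cm4 n hn, mul_pow, ← pow_mul, mul_div_mul_right _ _ (by positivity)]

theorem th_final :
    Tendsto (fun n : ℕ => rlAlpha 4 n) atTop
      (nhds ((-189 * Real.pi ^ 2 + 315 * Real.pi + 884) / (7 * (10 - 3 * Real.pi) ^ 2))) := by
  have hne : 10 - 3 * Real.pi ≠ 0 := by
    have := Real.pi_lt_d2
    linarith
  have hsq : √(Real.pi / 2) ^ 2 = Real.pi / 2 := Real.sq_sqrt (by positivity)
  have hd := (thM_2.sub (thM_1.pow 2)).pow 2
  have hN := ((thM_4.sub ((thM_3.const_mul 4).mul thM_1)).add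
    ((thM_2.const_mul 6).mul (thM_1.pow 2))).sub ((thM_1.pow 4).const_mul 3)
  have hne2 : (5 / 3 - √(Real.pi / 2) ^ 2) ^ 2 ≠ 0 := by
    rw [hsq]
    refine pow_ne_zero _ fun h => hne ?_
    linarith
  have h := hN.div hd hne2
  refine Tendsto.congr' ?_ (h.trans_eq ?_)
  · filter_upwards [eventually_ge_atTop 1] with n hn
    exact (th_alpha n hn).symm
  · congr 1
    have e4 : √(Real.pi / 2) ^ 4 = (Real.pi / 2) ^ 2 := by
      rw [show (4 : ℕ) = 2 * 2 from rfl, pow_mul, hsq]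
    have e2 : 4 * (15 / 8 * √(Real.pi / 2)) * √(Real.pi / 2) = 15 / 4 * Real.pi := by
      linear_combination 15 / 2 * hsq
    rw [e4, e2, hsq, div_eq_div_iff (by rw [← hsq]; exact hne2) (by positivity)]
    ring

end Fin

open Filter Real

/-- The `4`-th scaled moment of the total height on rooted labeled trees on `n`
vertices converges, as `n → ∞`, to the stated constant. -/
theorem totalheight_stmt15 :
    Tendsto (fun n : ℕ => rlAlpha 4 n) atTop
      (nhds ((-189 * π ^ 2 + 315 * π + 884) / (7 * (10 - 3 * π) ^ 2))) := by
  exact th_final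
end
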